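/- Fix an integer n ≥ 1. For every continuous compactly supported function f : ℝ^n → ℝ, lim_{N→∞} ∫_{ℝ^n} f(t_1,…,t_n) (π/(2N))^n R^{BT}_{n2}(πt_1/(2N),…,πt_n/(2N)) dt_1⋯dt_n = ∫_{ℝ^n} f(t_1,…,t_n) det[K_sine(t_j,t_k)]_{j,k=1}^n dt_1⋯dt_n. (Sine-kernel universality at zero for the bounded trace Gaussian unitary ensemble.) -/

import Mathlib

open MeasureTheory Filter Real Topology

noncomputable section

/-- The β-Vandermonde factor `∏_{j<k} |x_j - x_k|^β`. -/
def vand (β : ℝ) (N : ℕ) (x : Fin N → ℝ) : ℝ :=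
  ∏ p ∈ Finset.univ.filter (fun p : Fin N × Fin N => p.1 < p.2), |x p.1 - x p.2| ^ β

/-- `N_β = N + βN(N-1)/2`. -/
def Nbeta (β : ℝ) (N : ℕ) : ℝ := N + β * N * (N - 1) / 2

/-- Surface (Hausdorff) measure on the sphere of radius `r` in Euclidean `ℝ^N`. -/
def sphereMeasure (N : ℕ) (r : ℝ) : Measure (EuclideanSpace ℝ (Fin N)) :=
  (μH[(N : ℝ) - 1]).restrict (Metric.sphere (0 : EuclideanSpace ℝ (Fin N)) r)

/-- Normalization of the fixed trace ensemble: total `Δ_β`-mass of the sphere of radius `r`. -/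
def Zft (β : ℝ) (N : ℕ) (r : ℝ) : ℝ :=
  ∫ x, vand β N x ∂(sphereMeasure N r)

/-- Glue `(x_1,…,x_n)` and `(x_{n+1},…,x_N)` into a vector in `ℝ^N`. -/
def combine (N n : ℕ) (x : Fin n → ℝ) (y : Fin (N - n) → ℝ) : Fin N → ℝ := fun i =>
  if h : (i : ℕ) < n then x ⟨i, h⟩
  else y ⟨(i : ℕ) - n, by have := i.isLt; omega⟩

/-- `n`-point correlation function of the fixed trace Gaussian β-ensemble of strength `r`. -/
def Rft (β : ℝ) (n N : ℕ) (r : ℝ) (x : Fin n → ℝ) : ℝ :=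
  ((N.factorial : ℝ) / ((N - n).factorial : ℝ)) * (Zft β N r)⁻¹ *
    ∫ y, vand β N (combine N n x y)
      ∂(sphereMeasure (N - n) (Real.sqrt (r ^ 2 - ∑ i, x i ^ 2)))

/-- Normalization of the bounded trace ensemble. -/
def Zbt (β : ℝ) (N : ℕ) (r : ℝ) : ℝ :=
  ∫ x : Fin N → ℝ, Set.indicator {z : Fin N → ℝ | ∑ i, z i ^ 2 ≤ r ^ 2} (vand β N) x

/-- `n`-point correlation function of the bounded trace Gaussian β-ensemble of strength `r`. -/
def Rbt (β : ℝ) (n N : ℕ) (r : ℝ) (x : Fin n → ℝ) : ℝ :=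
  ((N.factorial : ℝ) / ((N - n).factorial : ℝ)) * (Zbt β N r)⁻¹ *
    ∫ y : Fin (N - n) → ℝ,
      Set.indicator {z : Fin N → ℝ | ∑ i, z i ^ 2 ≤ r ^ 2} (vand β N) (combine N n x y)

/-- Normalization of the (unconstrained) Gaussian β-ensemble. -/
def Zg (β : ℝ) (N : ℕ) : ℝ :=
  ∫ x : Fin N → ℝ, vand β N x * ∏ i, Real.exp (-(β * N * x i ^ 2))

/-- `n`-point correlation function of the Gaussian β-ensemble. -/
def Rg (β : ℝ) (n N : ℕ) (x : Fin n → ℝ) : ℝ :=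
  ((N.factorial : ℝ) / ((N - n).factorial : ℝ)) * (Zg β N)⁻¹ *
    ∫ y : Fin (N - n) → ℝ,
      vand β N (combine N n x y) * ∏ i, Real.exp (-(β * N * (combine N n x y i) ^ 2))

/-- The sine kernel `sin(π(x-y))/(π(x-y))`, with value `1` on the diagonal. -/
def Ksine (x y : ℝ) : ℝ :=
  if x = y then 1 else Real.sin (π * (x - y)) / (π * (x - y))

/-- `S(t) = sin(πt)/(πt)` with `S(0) = 1`. -/
def Ssin (t : ℝ) : ℝ := if t = 0 then 1 else Real.sin (π * t) / (π * t)

/-- The 2×2 matrix sine kernel for β = 1. -/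
def K1sine (x y : ℝ) : Fin 2 → Fin 2 → ℝ :=
  ![![Ssin (x - y), deriv Ssin (x - y)],
    ![(∫ t in (0:ℝ)..(x - y), Ssin t) - Real.sign (x - y) / 2, Ssin (x - y)]]

/-- The 2×2 matrix sine kernel for β = 4. -/
def K4sine (x y : ℝ) : Fin 2 → Fin 2 → ℝ :=
  ![![Ssin (2 * (x - y)), deriv (fun z => Ssin (2 * (z - y))) x],
    ![(∫ t in (0:ℝ)..(x - y), Ssin (2 * t)) - Real.sign (2 * (x - y)) / 2,
      Ssin (2 * (x - y))]]

/-- The Airy function `Ai(x) = lim_{T→∞} (1/π) ∫_0^T cos(t³/3 + xt) dt`. -/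
def Ai (x : ℝ) : ℝ :=
  limUnder atTop (fun T : ℝ => (1 / π) * ∫ t in (0:ℝ)..T, Real.cos (t ^ 3 / 3 + x * t))

/-- The Airy kernel. -/
def KAiry (x y : ℝ) : ℝ :=
  if x = y then (deriv Ai x) ^ 2 - x * (Ai x) ^ 2
  else (Ai x * deriv Ai y - deriv Ai x * Ai y) / (x - y)

/-- `C_{Nβ} = Γ(N_β/2)·2^{N_β/2−1}·β^{−N_β/2}`. -/
def Cnb (β : ℝ) (N : ℕ) : ℝ :=
  Real.Gamma (Nbeta β N / 2) * (2 : ℝ) ^ (Nbeta β N / 2 - 1) * β ^ (-(Nbeta β N) / 2)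

end

theorem det_bordered_mul_det {ι R : Type*} [Fintype ι] [DecidableEq ι] [CommRing R]
    (A : Matrix ι ι R) (B : Matrix ι Unit R) (C : Matrix Unit ι R) (D : Matrix Unit Unit R) :
    (Matrix.fromBlocks A B C D).det * A.det =
      (D () () * A.det - (C * A.adjugate * B) () ()) * A.det := by
  have h : Matrix.fromBlocks A B C D *
      Matrix.fromBlocks 1 (-(A.adjugate * B)) 0 (A.det • (1 : Matrix Unit Unit R)) =
      Matrix.fromBlocks A 0 C (A.det • D - C * A.adjugate * B) := by
    rw [Matrix.fromBlocks_multiply]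
    congr 1
    · simp
    · simp [← Matrix.mul_assoc, Matrix.mul_adjugate]
    · simp
    · simp [← Matrix.mul_assoc, sub_eq_add_neg, add_comm]
  have := congrArg Matrix.det h
  rw [Matrix.det_mul, Matrix.det_fromBlocks_zero₂₁, Matrix.det_fromBlocks_zero₁₂] at this
  simp at this
  rw [this]; ring

theorem det_fromBlocks_unit {ι R : Type*} [Fintype ι] [DecidableEq ι] [CommRing R]
    (A : Matrix ι ι R) (B : Matrix ι Unit R) (C : Matrix Unit ι R) (D : Matrix Unit Unit R) :
    (Matrix.fromBlocks A B C D).det =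
      D () () * A.det - (C * A.adjugate * B) () () := by
  let g : Matrix ι ι R → Matrix ι ι (Polynomial R) := fun M =>
    M.map Polynomial.C + (Polynomial.X : Polynomial R) • (1 : Matrix ι ι (Polynomial R))
  have hreg : IsRightRegular (g A).det := by
    have : (g A).det = Matrix.det ((Polynomial.X : Polynomial R) • (1 : Matrix ι ι (Polynomial R)) + A.map Polynomial.C) := by
      simp only [g, add_comm]
    rw [this]
    exact (show Polynomial.Monic _ from Polynomial.leadingCoeff_det_X_one_add_C A).isRegular.right
  have h := hreg (det_bordered_mul_det (g A) (B.map Polynomial.C) (C.map Polynomial.C)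
    (D.map Polynomial.C))
  have h2 := congrArg (Polynomial.evalRingHom (0 : R)) h
  rw [RingHom.map_det, map_sub, map_mul, RingHom.map_det] at h2
  have e1 : (Polynomial.evalRingHom (0 : R)).mapMatrix (Matrix.fromBlocks (g A) (B.map Polynomial.C)
      (C.map Polynomial.C) (D.map Polynomial.C)) = Matrix.fromBlocks A B C D := by
    ext i j; rcases i with i | i <;> rcases j with j | j <;> simp [g]
  have e2 : (Polynomial.evalRingHom (0 : R)).mapMatrix (g A) = A := by
    ext i j; simp [g]
  have e3 : (Polynomial.evalRingHom (0 : R)) ((C.map Polynomial.C * (g A).adjugate * B.map Polynomial.C) () ())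
      = (C * A.adjugate * B) () () := by
    have : ((C.map Polynomial.C * (g A).adjugate * B.map Polynomial.C).map (Polynomial.evalRingHom (0 : R))) = C * A.adjugate * B := by
      rw [Matrix.map_mul, Matrix.map_mul]
      congr 1
      · congr 1
        · ext; simp
        · have := (Polynomial.evalRingHom (0 : R)).map_adjugate (g A)
          rw [e2] at this; exact this
      · ext; simp
    rw [← this]; rfl
  rw [e1, e2, e3] at h2
  rw [h2]; simp

noncomputable section

/-- The kernel `∑ k, φ k x * φ k y` of a finite family of functions. -/
def familyKernel {N : ℕ} (φ : Fin N → ℝ → ℝ) (x y : ℝ) : ℝ := ∑ k, φ k x * φ k y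

/-- The determinant of the kernel of a finite family evaluated at a finite set of points. -/
def kernelDet {N : ℕ} (φ : Fin N → ℝ → ℝ) {ι : Type} [Fintype ι] [DecidableEq ι]
    (x : ι → ℝ) : ℝ :=
  Matrix.det (Matrix.of fun i j => familyKernel φ (x i) (x j))

end

theorem kernelDet_nonneg {N : ℕ} (φ : Fin N → ℝ → ℝ) {ι : Type} [Fintype ι] [DecidableEq ι]
    (x : ι → ℝ) : 0 ≤ kernelDet φ x := by
  let M : Matrix ι (Fin N) ℝ := Matrix.of fun i k => φ k (x i)
  have h : (Matrix.of fun i j => familyKernel φ (x i) (x j)) = M * M.conjTranspose := by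
    ext i j
    simp [M, familyKernel, Matrix.mul_apply]
  unfold kernelDet
  rw [h]
  exact (Matrix.posSemidef_self_mul_conjTranspose M).det_nonneg

theorem kernelDet_comp_equiv {N : ℕ} (φ : Fin N → ℝ → ℝ) {ι κ : Type} [Fintype ι]
    [DecidableEq ι] [Fintype κ] [DecidableEq κ] (e : κ ≃ ι) (x : ι → ℝ) :
    kernelDet φ (x ∘ e) = kernelDet φ x := by
  unfold kernelDet
  rw [← Matrix.det_submatrix_equiv_self e]
  rfl

theorem continuous_kernelDet {N : ℕ} {φ : Fin N → ℝ → ℝ} (hφ : ∀ k, Continuous (φ k))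
    {ι : Type} [Fintype ι] [DecidableEq ι] :
    Continuous (fun x : ι → ℝ => kernelDet φ x) := by
  unfold kernelDet familyKernel
  refine Continuous.matrix_det ?_
  refine continuous_matrix fun i j => ?_
  simp only [Matrix.of_apply]
  fun_prop

theorem kernelDet_sum_elim {N : ℕ} (φ : Fin N → ℝ → ℝ) {ι : Type} [Fintype ι] [DecidableEq ι]
    (x : ι → ℝ) (y : ℝ) :
    kernelDet φ (Sum.elim x (fun _ : Unit => y)) =
      familyKernel φ y y * kernelDet φ x -
        ∑ i, ∑ j, familyKernel φ y (x j) *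
          (Matrix.of fun i j => familyKernel φ (x i) (x j)).adjugate j i *
          familyKernel φ (x i) y := by
  have h : (Matrix.of fun i j => familyKernel φ (Sum.elim x (fun _ : Unit => y) i)
      (Sum.elim x (fun _ : Unit => y) j)) =
      Matrix.fromBlocks (Matrix.of fun i j => familyKernel φ (x i) (x j))
        (Matrix.of fun i _ => familyKernel φ (x i) y)
        (Matrix.of fun _ j => familyKernel φ y (x j))
        (Matrix.of fun _ _ => familyKernel φ y y) := by
    ext i j
    rcases i with i | i <;> rcases j with j | j <;> rfl
  rw [kernelDet, h, det_fromBlocks_unit]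
  simp [Matrix.mul_apply, Finset.sum_mul, kernelDet]

/-- Integrability and orthonormality of a finite family of functions on the line. -/
structure OrthonormalFamily {N : ℕ} (φ : Fin N → ℝ → ℝ) : Prop where
  continuous : ∀ k, Continuous (φ k)
  integrable : ∀ j k, Integrable fun x => φ j x * φ k x
  integral : ∀ j k, ∫ x, φ j x * φ k x = if j = k then 1 else 0

namespace OrthonormalFamily

variable {N : ℕ} {φ : Fin N → ℝ → ℝ}

theorem integrable_diag (h : OrthonormalFamily φ) :
    Integrable fun y => familyKernel φ y y :=
  integrable_finsetSum _ fun k _ => h.integrable k k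

theorem integral_diag (h : OrthonormalFamily φ) : ∫ y, familyKernel φ y y = N := by
  unfold familyKernel
  rw [integral_finsetSum _ fun k _ => h.integrable k k]
  simp [h.integral]

theorem kernel_mul_kernel (a b y : ℝ) : familyKernel φ a y * familyKernel φ y b =
    ∑ j, ∑ k, φ j a * φ k b * (φ j y * φ k y) := by
  unfold familyKernel
  rw [Finset.sum_mul_sum]
  refine Finset.sum_congr rfl fun j _ => Finset.sum_congr rfl fun k _ => by ring

theorem integrable_kernel_mul_kernel (h : OrthonormalFamily φ) (a b : ℝ) :
    Integrable fun y => familyKernel φ a y * familyKernel φ y b := by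
  simp only [kernel_mul_kernel]
  exact integrable_finsetSum _ fun j _ => integrable_finsetSum _ fun k _ =>
    (h.integrable j k).const_mul _

theorem integral_kernel_mul_kernel (h : OrthonormalFamily φ) (a b : ℝ) :
    ∫ y, familyKernel φ a y * familyKernel φ y b = familyKernel φ a b := by
  simp only [kernel_mul_kernel]
  rw [integral_finsetSum _ fun j _ => integrable_finsetSum _ fun k _ =>
    (h.integrable j k).const_mul _]
  simp_rw [integral_finsetSum _ fun k _ => (h.integrable _ k).const_mul _, integral_const_mul,
    h.integral]
  simp [familyKernel]

variable {ι : Type} [Fintype ι] [DecidableEq ι]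

theorem integrable_kernelDet_elim (h : OrthonormalFamily φ) (x : ι → ℝ) :
    Integrable fun y => kernelDet φ (Sum.elim x (fun _ : Unit => y)) := by
  simp only [kernelDet_sum_elim]
  refine (h.integrable_diag.mul_const _).sub ?_
  refine integrable_finsetSum _ fun i _ => integrable_finsetSum _ fun j _ => ?_
  refine ((h.integrable_kernel_mul_kernel (x i) (x j)).mul_const
    ((Matrix.of fun i j => familyKernel φ (x i) (x j)).adjugate j i)).congr ?_
  exact Filter.Eventually.of_forall fun y => by ring

theorem integral_kernelDet_elim (h : OrthonormalFamily φ) (x : ι → ℝ) :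
    ∫ y, kernelDet φ (Sum.elim x (fun _ : Unit => y)) =
      (N - Fintype.card ι) * kernelDet φ x := by
  have hc : ∀ i j, (fun y => familyKernel φ y (x j) *
          (Matrix.of fun i j => familyKernel φ (x i) (x j)).adjugate j i *
          familyKernel φ (x i) y) = fun y => (familyKernel φ (x i) y * familyKernel φ y (x j)) *
          (Matrix.of fun i j => familyKernel φ (x i) (x j)).adjugate j i := by
    intro i j; ext y; ring
  have hi : ∀ i j, Integrable (fun y => familyKernel φ y (x j) *
          (Matrix.of fun i j => familyKernel φ (x i) (x j)).adjugate j i *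
          familyKernel φ (x i) y) := by
    intro i j
    rw [hc]
    exact (h.integrable_kernel_mul_kernel (x i) (x j)).mul_const _
  simp only [kernelDet_sum_elim]
  rw [integral_sub (h.integrable_diag.mul_const _)
    (integrable_finsetSum _ fun i _ => integrable_finsetSum _ fun j _ => hi i j),
    integral_mul_const, h.integral_diag,
    integral_finsetSum _ fun i _ => integrable_finsetSum _ fun j _ => hi i j]
  simp_rw [integral_finsetSum _ fun j _ => hi _ j, hc, integral_mul_const,
    h.integral_kernel_mul_kernel]
  have htr : ∑ i, ∑ j, familyKernel φ (x i) (x j) *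
      (Matrix.of fun i j => familyKernel φ (x i) (x j)).adjugate j i =
      Matrix.trace ((Matrix.of fun i j => familyKernel φ (x i) (x j)) *
        (Matrix.of fun i j => familyKernel φ (x i) (x j)).adjugate) := by
    simp [Matrix.trace, Matrix.mul_apply]
  rw [htr, Matrix.mul_adjugate, Matrix.trace_smul, Matrix.trace_one, smul_eq_mul, ← kernelDet]
  ring

theorem lintegral_kernelDet_elim (h : OrthonormalFamily φ) (x : ι → ℝ) :
    ∫⁻ y, ENNReal.ofReal (kernelDet φ (Sum.elim x (fun _ : Unit => y))) =
      ENNReal.ofReal ((N - Fintype.card ι) * kernelDet φ x) := by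
  rw [← h.integral_kernelDet_elim,
    ofReal_integral_eq_lintegral_ofReal (h.integrable_kernelDet_elim x)]
  exact Filter.Eventually.of_forall fun y => kernelDet_nonneg _ _

end OrthonormalFamily

theorem OrthonormalFamily.lintegral_kernelDet {N : ℕ} {φ : Fin N → ℝ → ℝ}
    (h : OrthonormalFamily φ) (p : ℕ) : ∀ {ι : Type} [Fintype ι] [DecidableEq ι] (x : ι → ℝ),
      Fintype.card ι + p = N →
      ∫⁻ y : Fin p → ℝ, ENNReal.ofReal (kernelDet φ (Sum.elim x y)) =
        ENNReal.ofReal (p.factorial * kernelDet φ x) := by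
  induction p with
  | zero =>
    intro ι _ _ x _
    have : ∀ y : Fin 0 → ℝ, kernelDet φ (Sum.elim x y) = kernelDet φ x := by
      intro y
      rw [← kernelDet_comp_equiv φ (Equiv.sumEmpty ι (Fin 0)).symm]
      congr 1
    simp [this, volume_pi]
  | succ p ih =>
    intro ι _ _ x hcard
    have hmeas : Measurable fun y : Fin (p + 1) → ℝ =>
        ENNReal.ofReal (kernelDet φ (Sum.elim x y)) := by
      refine ENNReal.measurable_ofReal.comp (Continuous.measurable ?_)
      refine (continuous_kernelDet h.continuous).comp (continuous_pi ?_)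
      rintro (i | i) <;> simp <;> fun_prop
    rw [← ((volume_preserving_piFinSuccAbove (fun _ : Fin (p + 1) => ℝ) 0).symm).lintegral_comp
      hmeas]
    rw [Measure.volume_eq_prod, lintegral_prod]
    swap
    · exact (hmeas.comp (MeasurableEquiv.measurable _)).aemeasurable
    have key : ∀ (y : ℝ) (z : Fin p → ℝ), kernelDet φ (Sum.elim x
        ((MeasurableEquiv.piFinSuccAbove (fun _ : Fin (p + 1) => ℝ) 0).symm (y, z))) =
        kernelDet φ (Sum.elim (Sum.elim x (fun _ : Unit => y)) z) := by
      intro y z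
      let e : ι ⊕ Fin (p + 1) ≃ (ι ⊕ Unit) ⊕ Fin p :=
        ((Equiv.refl ι).sumCongr ((finSuccEquiv p).trans ((Equiv.optionEquivSumPUnit _).trans
          (Equiv.sumComm _ _)))).trans (Equiv.sumAssoc ι Unit (Fin p)).symm
      rw [← kernelDet_comp_equiv φ e]
      congr 1
      ext i
      rcases i with i | i
      · rfl
      · refine Fin.cases ?_ (fun i => ?_) i
        · simp [e, MeasurableEquiv.piFinSuccAbove]
        · simp [e, MeasurableEquiv.piFinSuccAbove]
    simp only [key]
    have hc : Fintype.card (ι ⊕ Unit) + p = N := by simp; omega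
    simp_rw [ih _ hc]
    simp_rw [ENNReal.ofReal_mul (Nat.cast_nonneg p.factorial)]
    rw [lintegral_const_mul', h.lintegral_kernelDet_elim, ← ENNReal.ofReal_mul (by positivity)]
    · congr 1
      have : (N : ℝ) = Fintype.card ι + (p + 1) := by rw [← hcard]; push_cast; ring
      rw [this, Nat.factorial_succ]
      push_cast
      ring
    · exact ENNReal.ofReal_ne_top

theorem vand_two_eq_det_sq {N : ℕ} (x : Fin N → ℝ) :
    vand 2 N x = (Matrix.vandermonde x).det ^ 2 := by
  rw [Matrix.det_vandermonde, vand, ← Finset.prod_pow]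
  rw [Finset.prod_filter, ← Finset.univ_product_univ, Finset.prod_product]
  refine Finset.prod_congr rfl fun i _ => ?_
  rw [← Finset.prod_pow, ← Finset.prod_filter]
  have : Finset.univ.filter (fun j => i < j) = Finset.Ioi i := by ext; simp
  rw [this]
  refine Finset.prod_congr rfl fun j _ => ?_
  rw [show (2 : ℝ) = ((2 : ℕ) : ℝ) by norm_num, Real.rpow_natCast, sq_abs]
  ring

theorem vand_two_nonneg {N : ℕ} (x : Fin N → ℝ) : 0 ≤ vand 2 N x := by
  rw [vand_two_eq_det_sq]; positivity

theorem continuous_vand_two (N : ℕ) : Continuous (vand 2 N) := by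
  have : vand 2 N = fun x => (Matrix.vandermonde x).det ^ 2 := by
    ext x; exact vand_two_eq_det_sq x
  rw [this]
  simp only [Matrix.det_vandermonde]
  fun_prop

theorem vand_two_smul {N : ℕ} (u : ℝ) (x : Fin N → ℝ) :
    vand 2 N (u • x) = u ^ (N * (N - 1)) * vand 2 N x := by
  have h : Matrix.vandermonde (u • x) =
      Matrix.of fun i j : Fin N => u ^ (j : ℕ) * Matrix.vandermonde x i j := by
    ext i j
    simp [Matrix.vandermonde_apply, mul_pow]
  rw [vand_two_eq_det_sq, vand_two_eq_det_sq, h, Matrix.det_mul_row, mul_pow,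
    Finset.prod_pow_eq_pow_sum, Fin.sum_univ_eq_sum_range (fun i => i) N, ← pow_mul,
    Finset.sum_range_id_mul_two]

noncomputable section

/-- The probabilists' Hermite polynomial with real coefficients. -/
def realHermite (k : ℕ) : Polynomial ℝ := (Polynomial.hermite k).map (Int.castRingHom ℝ)

/-- The squared norm `k! √(2π)` of the Hermite polynomial in `L²(exp(-x²/2))`. -/
def hermiteNormSq (k : ℕ) : ℝ := k.factorial * √(2 * π)

/-- The orthonormal Hermite functions. -/
def hermiteFun (k : ℕ) (x : ℝ) : ℝ :=
  (√(hermiteNormSq k))⁻¹ * ((realHermite k).eval x * exp (-(x ^ 2 / 4)))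

end

theorem hermiteNormSq_pos (k : ℕ) : 0 < hermiteNormSq k := by
  unfold hermiteNormSq
  positivity

theorem realHermite_monic (k : ℕ) : (realHermite k).Monic :=
  (Polynomial.hermite_monic k).map _

theorem natDegree_realHermite (k : ℕ) : (realHermite k).natDegree = k := by
  rw [realHermite, (Polynomial.hermite_monic k).natDegree_map, Polynomial.natDegree_hermite]

theorem realHermite_succ (k : ℕ) :
    realHermite (k + 1) = Polynomial.X * realHermite k - Polynomial.derivative (realHermite k) := by
  simp [realHermite, Polynomial.hermite_succ, Polynomial.derivative_map]

theorem integrable_polynomial_mul_gaussian (p : Polynomial ℝ) :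
    Integrable fun x : ℝ => p.eval x * exp (-(x ^ 2 / 2)) := by
  induction p using Polynomial.induction_on' with
  | add p q hp hq =>
    simp only [Polynomial.eval_add, add_mul]
    exact hp.add hq
  | monomial n a =>
    have h := integrable_rpow_mul_exp_neg_mul_sq (b := 1 / 2) (by norm_num) (s := n)
      (by linarith [(Nat.cast_nonneg n : (0 : ℝ) ≤ n)])
    refine (h.const_mul a).congr (Eventually.of_forall fun x => ?_)
    simp only [Real.rpow_natCast, Polynomial.eval_monomial]
    rw [show -(1 / 2) * x ^ 2 = -(x ^ 2 / 2) by ring]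
    ring

theorem integral_gaussian_by_parts (p q : Polynomial ℝ) :
    ∫ x : ℝ, ((Polynomial.X * p - Polynomial.derivative p) * q).eval x * exp (-(x ^ 2 / 2)) =
      ∫ x : ℝ, (p * Polynomial.derivative q).eval x * exp (-(x ^ 2 / 2)) := by
  have hg : ∀ x : ℝ, HasDerivAt (fun x : ℝ => exp (-(x ^ 2 / 2))) (-x * exp (-(x ^ 2 / 2))) x := by
    intro x
    have h1 : HasDerivAt (fun x : ℝ => -(x ^ 2 / 2)) (-x) x := by
      have := ((hasDerivAt_pow 2 x).div_const 2).neg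
      refine this.congr_deriv ?_
      norm_num
    convert h1.exp using 1
    ring
  have key := integral_mul_deriv_eq_deriv_mul_of_integrable
    (u := fun x => q.eval x) (u' := fun x => (Polynomial.derivative q).eval x)
    (v := fun x => p.eval x * exp (-(x ^ 2 / 2)))
    (v' := fun x => (Polynomial.derivative p).eval x * exp (-(x ^ 2 / 2)) +
      p.eval x * (-x * exp (-(x ^ 2 / 2))))
    (fun x _ => q.hasDerivAt x) (fun x _ => (p.hasDerivAt x).mul (hg x)) ?_ ?_ ?_
  · have e1 : ∀ x : ℝ, ((Polynomial.X * p - Polynomial.derivative p) * q).eval x *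
        exp (-(x ^ 2 / 2)) = -(q.eval x * ((Polynomial.derivative p).eval x * exp (-(x ^ 2 / 2)) +
          p.eval x * (-x * exp (-(x ^ 2 / 2))))) := by
      intro x; simp; ring
    simp_rw [e1]
    rw [integral_neg, key, neg_neg]
    congr 1
    ext x
    simp; ring
  · refine (integrable_polynomial_mul_gaussian
      (q * (Polynomial.derivative p - Polynomial.X * p))).congr (Eventually.of_forall fun x => ?_)
    simp; ring
  · refine (integrable_polynomial_mul_gaussian
      (Polynomial.derivative q * p)).congr (Eventually.of_forall fun x => ?_)
    simp; ring
  · refine (integrable_polynomial_mul_gaussian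
      (q * p)).congr (Eventually.of_forall fun x => ?_)
    simp; ring

theorem integral_realHermite_mul (k : ℕ) : ∀ q : Polynomial ℝ,
    ∫ x : ℝ, (realHermite k * q).eval x * exp (-(x ^ 2 / 2)) =
      ∫ x : ℝ, (Polynomial.derivative^[k] q).eval x * exp (-(x ^ 2 / 2)) := by
  induction k with
  | zero => intro q; simp [realHermite]
  | succ k ih =>
    intro q
    rw [realHermite_succ, integral_gaussian_by_parts, ih, Function.iterate_succ_apply]

theorem integral_exp_neg_sq_half : ∫ x : ℝ, exp (-(x ^ 2 / 2)) = √(2 * π) := by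
  have := integral_gaussian (1 / 2)
  rw [show π / (1 / 2) = 2 * π by ring] at this
  rw [← this]
  congr 1
  ext x
  congr 1
  ring

theorem integral_realHermite_mul_self (k : ℕ) :
    ∫ x : ℝ, (realHermite k * realHermite k).eval x * exp (-(x ^ 2 / 2)) = hermiteNormSq k := by
  have h : Polynomial.derivative^[k] (realHermite k) = Polynomial.C (k.factorial : ℝ) := by
    have hd : (Polynomial.derivative^[k] (realHermite k)).natDegree = 0 := by
      have := Polynomial.natDegree_iterate_derivative (realHermite k) k
      rw [natDegree_realHermite] at this
      omega
    rw [Polynomial.eq_C_of_natDegree_eq_zero hd, Polynomial.coeff_iterate_derivative]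
    have hm : (realHermite k).coeff k = 1 := by
      have := (realHermite_monic k).coeff_natDegree
      rwa [natDegree_realHermite] at this
    simp [hm, Nat.descFactorial_self]
  rw [integral_realHermite_mul, h]
  simp only [Polynomial.eval_C]
  rw [integral_const_mul, integral_exp_neg_sq_half, hermiteNormSq]

theorem integral_realHermite_mul_of_lt {j k : ℕ} (hjk : j < k) :
    ∫ x : ℝ, (realHermite k * realHermite j).eval x * exp (-(x ^ 2 / 2)) = 0 := by
  rw [integral_realHermite_mul, Polynomial.iterate_derivative_eq_zero]
  · simp
  · rwa [natDegree_realHermite]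

theorem hermiteFun_mul_hermiteFun (j k : ℕ) (x : ℝ) :
    hermiteFun j x * hermiteFun k x = ((√(hermiteNormSq j))⁻¹ * (√(hermiteNormSq k))⁻¹) *
      ((realHermite j * realHermite k).eval x * exp (-(x ^ 2 / 2))) := by
  have : exp (-(x ^ 2 / 2)) = exp (-(x ^ 2 / 4)) * exp (-(x ^ 2 / 4)) := by
    rw [← exp_add]; congr 1; ring
  rw [this, hermiteFun, hermiteFun, Polynomial.eval_mul]
  ring

theorem integral_hermiteFun_mul (j k : ℕ) :
    ∫ x, hermiteFun j x * hermiteFun k x = if j = k then 1 else 0 := by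
  simp_rw [hermiteFun_mul_hermiteFun, integral_const_mul]
  rcases lt_trichotomy j k with h | h | h
  · rw [mul_comm (realHermite j), integral_realHermite_mul_of_lt h, if_neg h.ne, mul_zero]
  · subst h
    rw [integral_realHermite_mul_self, if_pos rfl, ← mul_inv,
      Real.mul_self_sqrt (hermiteNormSq_pos j).le, inv_mul_cancel₀ (hermiteNormSq_pos j).ne']
  · rw [integral_realHermite_mul_of_lt h, if_neg h.ne', mul_zero]

theorem continuous_hermiteFun (k : ℕ) : Continuous (hermiteFun k) := by
  unfold hermiteFun
  have := (realHermite k).continuous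
  fun_prop

theorem orthonormalFamily_hermiteFun (N : ℕ) :
    OrthonormalFamily fun k : Fin N => hermiteFun k where
  continuous k := continuous_hermiteFun k
  integrable j k := by
    simp_rw [hermiteFun_mul_hermiteFun]
    exact (integrable_polynomial_mul_gaussian _).const_mul _
  integral j k := by
    rw [integral_hermiteFun_mul]
    simp [Fin.val_inj]

theorem vand_two_mul_gaussian {N : ℕ} (x : Fin N → ℝ) :
    vand 2 N x * exp (-((∑ i, x i ^ 2) / 2)) =
      (∏ k : Fin N, hermiteNormSq k) * kernelDet (fun k : Fin N => hermiteFun k) x := by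
  let M : Matrix (Fin N) (Fin N) ℝ := Matrix.of fun i k => hermiteFun k (x i)
  have hM : kernelDet (fun k : Fin N => hermiteFun k) x = M.det ^ 2 := by
    have h : (Matrix.of fun i j => familyKernel (fun k : Fin N => hermiteFun k) (x i) (x j)) =
        M * M.transpose := by
      ext i j
      simp [M, familyKernel, Matrix.mul_apply]
    rw [kernelDet, h, Matrix.det_mul, Matrix.det_transpose, sq]
  have hdet : M.det = (∏ k : Fin N, (√(hermiteNormSq k))⁻¹) *
      ((∏ i, exp (-(x i ^ 2 / 4))) * (Matrix.vandermonde x).det) := by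
    rw [Matrix.det_eval_matrixOfPolynomials_eq_det_vandermonde x (fun k => realHermite k)
      (fun k => natDegree_realHermite k) (fun k => realHermite_monic k),
      ← Matrix.det_mul_column, ← Matrix.det_mul_row]
    congr 1
    ext i k
    simp only [M, Matrix.of_apply, hermiteFun]
    ring
  have hn : (∏ k : Fin N, hermiteNormSq k) * (∏ k : Fin N, (√(hermiteNormSq k))⁻¹) ^ 2 = 1 := by
    rw [← Finset.prod_pow, ← Finset.prod_mul_distrib]
    refine Finset.prod_eq_one fun k _ => ?_
    rw [inv_pow, Real.sq_sqrt (hermiteNormSq_pos k).le, mul_inv_cancel₀ (hermiteNormSq_pos k).ne']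
  have he : exp (-((∑ i, x i ^ 2) / 2)) = (∏ i, exp (-(x i ^ 2 / 4))) ^ 2 := by
    rw [← Finset.prod_pow, Finset.sum_div, ← Finset.sum_neg_distrib, Real.exp_sum]
    refine Finset.prod_congr rfl fun i _ => ?_
    rw [← Real.exp_nat_mul]
    congr 1
    push_cast
    ring
  rw [hM, hdet, mul_pow, mul_pow, ← mul_assoc, hn, vand_two_eq_det_sq, he]
  ring

theorem sum_range_of_odd_eq_zero {a : ℕ → ℝ} (h : ∀ j, a (2 * j + 1) = 0) (m : ℕ) :
    ∑ i ∈ Finset.range (2 * m + 1), a i = ∑ j ∈ Finset.range (m + 1), a (2 * j) := by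
  induction m with
  | zero => simp
  | succ m ih =>
    rw [show 2 * (m + 1) + 1 = 2 * m + 1 + 1 + 1 by ring, Finset.sum_range_succ,
      Finset.sum_range_succ, ih, h, Finset.sum_range_succ _ (m + 1)]
    simp [mul_add]

theorem sum_range_of_even_eq_zero {a : ℕ → ℝ} (h : ∀ j, a (2 * j) = 0) (m : ℕ) :
    ∑ i ∈ Finset.range (2 * m + 1 + 1), a i = ∑ j ∈ Finset.range (m + 1), a (2 * j + 1) := by
  induction m with
  | zero => simpa [Finset.sum_range_succ] using h 0
  | succ m ih =>
    rw [show 2 * (m + 1) + 1 + 1 = 2 * m + 1 + 1 + 1 + 1 by ring, Finset.sum_range_succ,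
      Finset.sum_range_succ, ih, show 2 * m + 1 + 1 = 2 * (m + 1) by ring, h,
      Finset.sum_range_succ _ (m + 1)]
    simp [show 2 * (m + 1) + 1 = 2 * m + 3 by ring]

theorem sum_range_split_parity (a : ℕ → ℝ) (N : ℕ) :
    ∑ k ∈ Finset.range N, a k = ∑ m ∈ Finset.range N,
      ((if 2 * m < N then a (2 * m) else 0) + (if 2 * m + 1 < N then a (2 * m + 1) else 0)) := by
  have h : ∀ (b : ℕ → ℝ) (M : ℕ), ∑ m ∈ Finset.range M, (b (2 * m) + b (2 * m + 1)) =
      ∑ k ∈ Finset.range (2 * M), b k := by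
    intro b M
    induction M with
    | zero => simp
    | succ M ih =>
      rw [Finset.sum_range_succ, ih, show 2 * (M + 1) = 2 * M + 1 + 1 by ring,
        Finset.sum_range_succ, Finset.sum_range_succ]
      ring
  rw [h (fun k => if k < N then a k else 0) N, ← Finset.sum_filter]
  refine Finset.sum_congr ?_ fun _ _ => rfl
  ext k
  simp
  omega

theorem doubleFactorial_two_mul_sub_one (k : ℕ) :
    ((2 * k - 1).doubleFactorial : ℝ) = (2 * k).factorial / (2 ^ k * k.factorial) := by
  rcases k with _ | k
  · simp
  · have h1 := Nat.factorial_eq_mul_doubleFactorial (2 * k + 1)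
    have h2 := Nat.doubleFactorial_two_mul (k + 1)
    rw [show 2 * k + 1 + 1 = 2 * (k + 1) by ring, h2] at h1
    rw [show 2 * (k + 1) - 1 = 2 * k + 1 by omega, h1]
    push_cast
    have : ((k + 1).factorial : ℝ) ≠ 0 := by positivity
    field_simp

noncomputable section

/-- The even Hermite polynomial of degree `2m`, normalized to be `1` at the origin, at `a/√N`. -/
def evenProfile (N m : ℕ) (a : ℝ) : ℝ :=
  ∑' j : ℕ, (-1) ^ j * (2 ^ j * ((m.descFactorial j : ℝ) / N ^ j) * a ^ (2 * j) /
    (2 * j).factorial)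

/-- The odd Hermite polynomial of degree `2m+1`, normalized to have derivative `1` at the origin,
at `a/√N` and multiplied by `√N`. -/
def oddProfile (N m : ℕ) (a : ℝ) : ℝ :=
  ∑' j : ℕ, (-1) ^ j * (2 ^ j * ((m.descFactorial j : ℝ) / N ^ j) * a ^ (2 * j + 1) /
    (2 * j + 1).factorial)

/-- The central binomial probability `(2m)! / (4^m m!²)`. -/
def centralProb (m : ℕ) : ℝ := (2 * m).factorial / (4 ^ m * (m.factorial : ℝ) ^ 2)

end

theorem eval_realHermite_even (m : ℕ) {N : ℕ} (hN : 0 < N) (a : ℝ) :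
    (realHermite (2 * m)).eval (a / √N) =
      (-1) ^ m * ((2 * m).factorial / (2 ^ m * m.factorial)) * evenProfile N m a := by
  have hN' : (0 : ℝ) < N := by exact_mod_cast hN
  rw [evenProfile, tsum_eq_sum (s := Finset.range (m + 1)), Polynomial.eval_eq_sum_range,
    natDegree_realHermite, sum_range_of_odd_eq_zero, Finset.mul_sum]
  · refine Finset.sum_congr rfl fun j hj => ?_
    obtain ⟨k, rfl⟩ : ∃ k, m = k + j := ⟨m - j, by simp at hj; omega⟩
    have h1 := Polynomial.coeff_hermite_explicit k (2 * j)
    rw [show 2 * k + 2 * j = 2 * (k + j) by ring] at h1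
    rw [realHermite, Polynomial.coeff_map, h1]
    have h2 : ((2 * (k + j)).choose (2 * j) : ℝ) =
        (2 * (k + j)).factorial / ((2 * j).factorial * (2 * k).factorial) := by
      rw [Nat.cast_choose ℝ (by omega), show 2 * (k + j) - 2 * j = 2 * k by omega]
    have h3 : ((k + j).descFactorial j : ℝ) = (k + j).factorial / k.factorial := by
      have := Nat.factorial_mul_descFactorial (show j ≤ k + j by omega)
      rw [Nat.add_sub_cancel] at this
      rw [← this]; push_cast; field_simp
    have h4 : (a / √N) ^ (2 * j) = a ^ (2 * j) / N ^ j := by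
      rw [div_pow, pow_mul (√(N : ℝ)), Real.sq_sqrt hN'.le]
    simp only [eq_intCast, Int.cast_mul, Int.cast_pow, Int.cast_neg, Int.cast_one, Int.cast_natCast]
    rw [h2, h3, h4, doubleFactorial_two_mul_sub_one]
    have h5 : ((-1 : ℝ)) ^ (k + j) * (-1) ^ j = (-1) ^ k := by
      rw [pow_add, mul_assoc, ← mul_pow]; simp
    rw [← h5, pow_add (2 : ℝ)]
    field_simp
  · intro j
    rw [realHermite, Polynomial.coeff_map, Polynomial.coeff_hermite_of_odd_add]
    · simp
    · exact ⟨m + j, by ring⟩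
  · intro j hj
    have : m.descFactorial j = 0 := Nat.descFactorial_eq_zero_iff_lt.2 (by simp at hj; omega)
    simp [this]

theorem eval_realHermite_odd (m : ℕ) {N : ℕ} (hN : 0 < N) (a : ℝ) :
    (realHermite (2 * m + 1)).eval (a / √N) =
      (-1) ^ m * ((2 * m + 1).factorial / (2 ^ m * m.factorial)) * (oddProfile N m a / √N) := by
  have hN' : (0 : ℝ) < N := by exact_mod_cast hN
  have hs : (0 : ℝ) < √N := by positivity
  rw [oddProfile, tsum_eq_sum (s := Finset.range (m + 1)), Polynomial.eval_eq_sum_range,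
    natDegree_realHermite, sum_range_of_even_eq_zero, Finset.sum_div, Finset.mul_sum]
  · refine Finset.sum_congr rfl fun j hj => ?_
    obtain ⟨k, rfl⟩ : ∃ k, m = k + j := ⟨m - j, by simp at hj; omega⟩
    have h1 := Polynomial.coeff_hermite_explicit k (2 * j + 1)
    rw [show 2 * k + (2 * j + 1) = 2 * (k + j) + 1 by ring] at h1
    rw [realHermite, Polynomial.coeff_map, h1]
    have h2 : ((2 * (k + j) + 1).choose (2 * j + 1) : ℝ) =
        (2 * (k + j) + 1).factorial / ((2 * j + 1).factorial * (2 * k).factorial) := by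
      rw [Nat.cast_choose ℝ (by omega), show 2 * (k + j) + 1 - (2 * j + 1) = 2 * k by omega]
    have h3 : ((k + j).descFactorial j : ℝ) = (k + j).factorial / k.factorial := by
      have := Nat.factorial_mul_descFactorial (show j ≤ k + j by omega)
      rw [Nat.add_sub_cancel] at this
      rw [← this]; push_cast; field_simp
    have h4 : (a / √N) ^ (2 * j + 1) = a ^ (2 * j + 1) / (N ^ j * √N) := by
      rw [div_pow, pow_succ (√(N : ℝ)), pow_mul (√(N : ℝ)), Real.sq_sqrt hN'.le]
    simp only [eq_intCast, Int.cast_mul, Int.cast_pow, Int.cast_neg, Int.cast_one, Int.cast_natCast]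
    rw [h2, h3, h4, doubleFactorial_two_mul_sub_one]
    have h5 : ((-1 : ℝ)) ^ (k + j) * (-1) ^ j = (-1) ^ k := by
      rw [pow_add, mul_assoc, ← mul_pow]; simp
    rw [← h5, pow_add (2 : ℝ)]
    field_simp
  · intro j
    rw [realHermite, Polynomial.coeff_map, Polynomial.coeff_hermite_of_odd_add]
    · simp
    · exact ⟨m + j, by ring⟩
  · intro j hj
    have : m.descFactorial j = 0 := Nat.descFactorial_eq_zero_iff_lt.2 (by simp at hj; omega)
    simp [this]

theorem descFactorial_div_pow_nonneg (N m j : ℕ) : (0 : ℝ) ≤ (m.descFactorial j : ℝ) / N ^ j := by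
  positivity

theorem descFactorial_div_pow_le_one {N m : ℕ} (h : m ≤ N) (j : ℕ) :
    (m.descFactorial j : ℝ) / N ^ j ≤ 1 := by
  refine div_le_one_of_le₀ ?_ (by positivity)
  exact_mod_cast (Nat.descFactorial_le_pow m j).trans (Nat.pow_le_pow_left h j)

theorem norm_evenTerm_le {N m : ℕ} (h : m ≤ N) (a : ℝ) (j : ℕ) :
    ‖(-1) ^ j * (2 ^ j * ((m.descFactorial j : ℝ) / N ^ j) * a ^ (2 * j) /
      (2 * j).factorial)‖ ≤ (2 * a ^ 2) ^ j / j.factorial := by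
  have h1 := descFactorial_div_pow_nonneg N m j
  have h2 := descFactorial_div_pow_le_one h j
  rw [norm_mul, norm_pow, norm_neg, norm_one, one_pow, one_mul, pow_mul, Real.norm_of_nonneg
    (by positivity), mul_pow]
  calc 2 ^ j * ((m.descFactorial j : ℝ) / N ^ j) * (a ^ 2) ^ j / (2 * j).factorial
      ≤ 2 ^ j * 1 * (a ^ 2) ^ j / j.factorial := by
        gcongr
        omega
    _ = _ := by ring

theorem norm_oddTerm_le {N m : ℕ} (h : m ≤ N) (a : ℝ) (j : ℕ) :
    ‖(-1) ^ j * (2 ^ j * ((m.descFactorial j : ℝ) / N ^ j) * a ^ (2 * j + 1) /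
      (2 * j + 1).factorial)‖ ≤ |a| * ((2 * a ^ 2) ^ j / j.factorial) := by
  have h1 := descFactorial_div_pow_nonneg N m j
  have h2 := descFactorial_div_pow_le_one h j
  have : 2 ^ j * ((m.descFactorial j : ℝ) / N ^ j) * a ^ (2 * j + 1) / (2 * j + 1).factorial =
    a * (2 ^ j * ((m.descFactorial j : ℝ) / N ^ j) * (a ^ 2) ^ j / (2 * j + 1).factorial) := by
    rw [← pow_mul]; ring
  rw [this, norm_mul, norm_pow, norm_neg, norm_one, one_pow, one_mul, norm_mul, Real.norm_eq_abs a,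
    Real.norm_of_nonneg (by positivity), mul_pow]
  refine mul_le_mul_of_nonneg_left ?_ (abs_nonneg a)
  calc 2 ^ j * ((m.descFactorial j : ℝ) / N ^ j) * (a ^ 2) ^ j / (2 * j + 1).factorial
      ≤ 2 ^ j * 1 * (a ^ 2) ^ j / j.factorial := by
        gcongr
        omega
    _ = _ := by ring

theorem hasSum_exp_series (x : ℝ) : HasSum (fun j : ℕ => x ^ j / j.factorial) (exp x) := by
  rw [Real.exp_eq_exp_ℝ]
  exact NormedSpace.expSeries_div_hasSum_exp x

theorem abs_evenProfile_le {N m : ℕ} (h : m ≤ N) (a : ℝ) :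
    |evenProfile N m a| ≤ exp (2 * a ^ 2) :=
  tsum_of_norm_bounded (hasSum_exp_series _) (norm_evenTerm_le h a)

theorem abs_oddProfile_le {N m : ℕ} (h : m ≤ N) (a : ℝ) :
    |oddProfile N m a| ≤ |a| * exp (2 * a ^ 2) :=
  tsum_of_norm_bounded ((hasSum_exp_series _).mul_left _) (norm_oddTerm_le h a)

theorem tendsto_descFactorial_div_pow {m : ℕ → ℕ} {u : ℝ}
    (hu : Tendsto (fun N : ℕ => (m N : ℝ) / N) atTop (𝓝 u)) (j : ℕ) :
    Tendsto (fun N : ℕ => ((m N).descFactorial j : ℝ) / N ^ j) atTop (𝓝 (u ^ j)) := by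
  induction j with
  | zero => simp
  | succ j ih =>
    have h1 : Tendsto (fun N : ℕ => ((m N - j : ℕ) : ℝ) / N) atTop (𝓝 u) := by
      have h2 : Tendsto (fun N : ℕ => (m N : ℝ) / N - j / N) atTop (𝓝 (u - 0)) :=
        hu.sub (tendsto_const_div_atTop_nhds_zero_nat _)
      rw [sub_zero] at h2
      refine tendsto_of_tendsto_of_tendsto_of_le_of_le h2 hu (fun N => ?_) (fun N => ?_)
      · simp only
        rw [← sub_div]
        gcongr
        have : m N ≤ (m N - j) + j := by omega
        have : (m N : ℝ) ≤ ((m N - j : ℕ) : ℝ) + j := by exact_mod_cast this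
        linarith
      · simp only
        gcongr
        omega
    have := h1.mul ih
    rw [← pow_succ'] at this
    refine this.congr fun N => ?_
    rw [Nat.descFactorial_succ, pow_succ]
    push_cast
    rw [div_mul_div_comm, mul_comm (N : ℝ)]

theorem tendsto_evenProfile {m : ℕ → ℕ} {u : ℝ} (h0 : 0 ≤ u) (hm : ∀ N, m N ≤ N)
    (hu : Tendsto (fun N : ℕ => (m N : ℝ) / N) atTop (𝓝 u)) (a : ℝ) :
    Tendsto (fun N => evenProfile N (m N) a) atTop (𝓝 (cos (√(2 * u) * a))) := by
  have hcos : cos (√(2 * u) * a) =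
      ∑' j : ℕ, (-1) ^ j * (2 ^ j * u ^ j * a ^ (2 * j) / (2 * j).factorial) := by
    rw [← (Real.hasSum_cos (√(2 * u) * a)).tsum_eq]
    refine tsum_congr fun j => ?_
    rw [mul_pow, pow_mul (√(2 * u)), Real.sq_sqrt (by positivity), mul_pow]
    ring
  rw [hcos]
  refine tendsto_tsum_of_dominated_convergence (hasSum_exp_series (2 * a ^ 2)).summable
    (fun j => ?_) (Eventually.of_forall fun N j => norm_evenTerm_le (hm N) a j)
  exact ((((tendsto_descFactorial_div_pow hu j).const_mul _).mul_const _).div_const _).const_mul _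

theorem tendsto_oddProfile {m : ℕ → ℕ} {u : ℝ} (h0 : 0 < u) (hm : ∀ N, m N ≤ N)
    (hu : Tendsto (fun N : ℕ => (m N : ℝ) / N) atTop (𝓝 u)) (a : ℝ) :
    Tendsto (fun N => oddProfile N (m N) a) atTop (𝓝 (sin (√(2 * u) * a) / √(2 * u))) := by
  have hs : (0 : ℝ) < √(2 * u) := by positivity
  have hsin : sin (√(2 * u) * a) / √(2 * u) =
      ∑' j : ℕ, (-1) ^ j * (2 ^ j * u ^ j * a ^ (2 * j + 1) / (2 * j + 1).factorial) := by
    rw [← ((Real.hasSum_sin (√(2 * u) * a)).div_const _).tsum_eq]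
    refine tsum_congr fun j => ?_
    rw [mul_pow, pow_succ (√(2 * u)), pow_mul (√(2 * u)), Real.sq_sqrt (by positivity), mul_pow]
    field_simp
  rw [hsin]
  refine tendsto_tsum_of_dominated_convergence
    ((hasSum_exp_series (2 * a ^ 2)).mul_left |a|).summable
    (fun j => ?_) (Eventually.of_forall fun N j => norm_oddTerm_le (hm N) a j)
  exact ((((tendsto_descFactorial_div_pow hu j).const_mul _).mul_const _).div_const _).const_mul _

theorem centralProb_eq_sqrt (m : ℕ) : centralProb m = √(1 / (Wallis.W m * (2 * m + 1))) := by
  rw [eq_comm, Real.sqrt_eq_iff_mul_self_eq_of_pos]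
  · rw [Wallis.W_eq_factorial_ratio, centralProb, show (4 : ℝ) = 2 ^ 2 by norm_num, ← pow_mul,
      show 4 * m = 2 * m + 2 * m by ring, pow_add]
    field_simp
  · unfold centralProb; positivity

theorem half_le_W (m : ℕ) : 1 / 2 ≤ Wallis.W m := by
  refine le_trans ?_ (Wallis.le_W m)
  have h1 : (1 : ℝ) / 2 ≤ (2 * m + 1) / (2 * m + 2) := by
    rw [div_le_div_iff₀ (by norm_num) (by positivity)]
    have : (0 : ℝ) ≤ m := Nat.cast_nonneg m
    linarith
  nlinarith [Real.pi_gt_three]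

theorem centralProb_nonneg (m : ℕ) : 0 ≤ centralProb m := by unfold centralProb; positivity

theorem centralProb_le (m : ℕ) : centralProb m ≤ √(2 / (m + 1)) := by
  rw [centralProb_eq_sqrt]
  refine Real.sqrt_le_sqrt ?_
  have h := half_le_W m
  have h0 : (0 : ℝ) ≤ m := Nat.cast_nonneg m
  rw [div_le_div_iff₀ (by positivity) (by positivity)]
  nlinarith

theorem sqrt_mul_centralProb_floor_le (N : ℕ) {u : ℝ} (hu : 0 < u) :
    √N * centralProb ⌊(N : ℝ) * u⌋₊ ≤ √2 * u ^ (-(1 / 2) : ℝ) := by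
  have h1 : (N : ℝ) * u < ⌊(N : ℝ) * u⌋₊ + 1 := Nat.lt_floor_add_one _
  calc √N * centralProb ⌊(N : ℝ) * u⌋₊ ≤ √N * √(2 / (⌊(N : ℝ) * u⌋₊ + 1)) := by
        gcongr; exact centralProb_le _
    _ = √(N * (2 / (⌊(N : ℝ) * u⌋₊ + 1))) := by rw [Real.sqrt_mul (Nat.cast_nonneg N)]
    _ ≤ √(2 * u⁻¹) := by
        refine Real.sqrt_le_sqrt ?_
        rw [← mul_div_assoc, div_le_iff₀ (by positivity), mul_assoc, mul_comm (N : ℝ)]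
        have h2 : (N : ℝ) ≤ u⁻¹ * (⌊(N : ℝ) * u⌋₊ + 1) := by
          rw [inv_mul_eq_div, le_div_iff₀ hu]
          exact h1.le
        linarith
    _ = _ := by
        rw [Real.sqrt_mul (by norm_num), Real.rpow_neg hu.le, ← Real.sqrt_eq_rpow, Real.sqrt_inv]

theorem tendsto_floor_div {u : ℝ} (hu : 0 ≤ u) :
    Tendsto (fun N : ℕ => (⌊(N : ℝ) * u⌋₊ : ℝ) / N) atTop (𝓝 u) := by
  have := (tendsto_nat_floor_mul_div_atTop (R := ℝ) hu).comp tendsto_natCast_atTop_atTop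
  refine this.congr fun N => ?_
  simp [mul_comm]

theorem tendsto_sqrt_mul_centralProb {u : ℝ} (hu : 0 < u) :
    Tendsto (fun N : ℕ => √N * centralProb ⌊(N : ℝ) * u⌋₊) atTop (𝓝 (√(1 / (π * u)))) := by
  have hfl : Tendsto (fun N : ℕ => ⌊(N : ℝ) * u⌋₊) atTop atTop :=
    tendsto_nat_floor_atTop.comp (tendsto_natCast_atTop_atTop.atTop_mul_const hu)
  have hW := Wallis.tendsto_W_nhds_pi_div_two.comp hfl
  have h1 : Tendsto (fun N : ℕ => (2 * (⌊(N : ℝ) * u⌋₊ : ℝ) + 1) / N) atTop (𝓝 (2 * u + 0)) := by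
    refine (((tendsto_floor_div hu.le).const_mul 2).add
      (tendsto_const_div_atTop_nhds_zero_nat 1)).congr fun N => ?_
    ring
  have h2 := (hW.mul h1).inv₀ (by positivity)
  have h3 := (Real.continuous_sqrt.tendsto _).comp h2
  have e : (π / 2 * (2 * u + 0))⁻¹ = 1 / (π * u) := by
    rw [add_zero, one_div]; congr 1; ring
  rw [e] at h3
  refine h3.congr fun N => ?_
  rw [centralProb_eq_sqrt, ← Real.sqrt_mul (Nat.cast_nonneg N)]
  simp only [Function.comp]
  congr 1
  rw [← mul_div_assoc, inv_div]
  ring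

theorem integral_floor (h : ℕ → ℝ) (M : ℕ) :
    IntervalIntegrable (fun x : ℝ => h ⌊x⌋₊) volume 0 M ∧
    ∫ x in (0 : ℝ)..M, h ⌊x⌋₊ = ∑ m ∈ Finset.range M, h m := by
  have hpiece : ∀ k : ℕ, Set.EqOn (fun _ : ℝ => h k) (fun x : ℝ => h ⌊x⌋₊)
      (Set.Ioo (k : ℝ) ((k + 1 : ℕ) : ℝ)) := by
    intro k x hx
    have : ⌊x⌋₊ = k := by
      rw [Nat.floor_eq_iff (le_trans (Nat.cast_nonneg k) hx.1.le)]
      exact ⟨hx.1.le, by simpa using hx.2⟩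
    simp [this]
  have hinteg : ∀ k : ℕ, IntervalIntegrable (fun x : ℝ => h ⌊x⌋₊) volume (k : ℝ) ((k + 1 : ℕ) : ℝ) := by
    intro k
    refine (intervalIntegrable_iff_integrableOn_Ioo_of_le (by simp)).2 ?_
    exact (integrableOn_const (C := h k) (by simp)).congr_fun (hpiece k) measurableSet_Ioo
  constructor
  · have := IntervalIntegrable.trans_iterate (a := fun k : ℕ => (k : ℝ)) (n := M)
      (fun k _ => hinteg k)
    simpa using this
  · have := intervalIntegral.sum_integral_adjacent_intervals (a := fun k : ℕ => (k : ℝ)) (n := M)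
      (fun k _ => hinteg k)
    simp only [Nat.cast_zero] at this
    rw [← this]
    refine Finset.sum_congr rfl fun k _ => ?_
    rw [intervalIntegral.integral_of_le (by simp), integral_Ioc_eq_integral_Ioo,
      ← setIntegral_congr_fun measurableSet_Ioo (hpiece k)]
    simp

theorem integral_floor_mul (h : ℕ → ℝ) (N : ℕ) :
    (N : ℝ) * ∫ u in (0 : ℝ)..1, h ⌊(N : ℝ) * u⌋₊ = ∑ m ∈ Finset.range N, h m := by
  rw [← (integral_floor h N).2]
  have := intervalIntegral.mul_integral_comp_mul_left (a := 0) (b := 1)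
    (f := fun x : ℝ => h ⌊x⌋₊) (N : ℝ)
  simpa using this

noncomputable section

/-- The joint contribution of the Hermite functions of degrees `2m` and `2m+1`
to the rescaled kernel. -/
def kernelTerm (N : ℕ) (a b : ℝ) (m : ℕ) : ℝ :=
  centralProb m * ((if 2 * m < N then evenProfile N m a * evenProfile N m b else 0) +
    (if 2 * m + 1 < N then (2 * m + 1) / N * (oddProfile N m a * oddProfile N m b) else 0))

end

theorem hermiteFun_mul_even (m : ℕ) {N : ℕ} (hN : 0 < N) (a b : ℝ) :
    hermiteFun (2 * m) (a / √N) * hermiteFun (2 * m) (b / √N) =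
      exp (-((a ^ 2 + b ^ 2) / (4 * N))) * (√(2 * π))⁻¹ *
        (centralProb m * (evenProfile N m a * evenProfile N m b)) := by
  have hN' : (0 : ℝ) < N := by exact_mod_cast hN
  have he : exp (-((a / √N) ^ 2 / 4)) * exp (-((b / √N) ^ 2 / 4)) =
      exp (-((a ^ 2 + b ^ 2) / (4 * N))) := by
    rw [← exp_add, div_pow, div_pow, Real.sq_sqrt hN'.le]
    congr 1
    field_simp
    ring
  have hn : (√(hermiteNormSq (2 * m)))⁻¹ * (√(hermiteNormSq (2 * m)))⁻¹ =
      (√(2 * π))⁻¹ * ((2 * m).factorial : ℝ)⁻¹ := by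
    rw [← mul_inv, Real.mul_self_sqrt (hermiteNormSq_pos _).le, hermiteNormSq, mul_inv, mul_comm]
  have hsign : ((-1 : ℝ) ^ m) * (-1) ^ m = 1 := by rw [← mul_pow]; simp
  unfold hermiteFun
  rw [eval_realHermite_even m hN, eval_realHermite_even m hN]
  calc _ = ((√(hermiteNormSq (2 * m)))⁻¹ * (√(hermiteNormSq (2 * m)))⁻¹) *
        (exp (-((a / √N) ^ 2 / 4)) * exp (-((b / √N) ^ 2 / 4))) * (((-1 : ℝ) ^ m) * (-1) ^ m) *
        (((2 * m).factorial / (2 ^ m * m.factorial)) ^ 2) *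
        (evenProfile N m a * evenProfile N m b) := by ring
    _ = _ := by
      rw [he, hn, hsign, centralProb, show (4 : ℝ) = 2 ^ 2 by norm_num, ← pow_mul, mul_comm 2 m,
        pow_mul]
      field_simp

theorem hermiteFun_mul_odd (m : ℕ) {N : ℕ} (hN : 0 < N) (a b : ℝ) :
    hermiteFun (2 * m + 1) (a / √N) * hermiteFun (2 * m + 1) (b / √N) =
      exp (-((a ^ 2 + b ^ 2) / (4 * N))) * (√(2 * π))⁻¹ *
        (centralProb m * ((2 * m + 1) / N * (oddProfile N m a * oddProfile N m b))) := by
  have hN' : (0 : ℝ) < N := by exact_mod_cast hN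
  have he : exp (-((a / √N) ^ 2 / 4)) * exp (-((b / √N) ^ 2 / 4)) =
      exp (-((a ^ 2 + b ^ 2) / (4 * N))) := by
    rw [← exp_add, div_pow, div_pow, Real.sq_sqrt hN'.le]
    congr 1
    field_simp
    ring
  have hn : (√(hermiteNormSq (2 * m + 1)))⁻¹ * (√(hermiteNormSq (2 * m + 1)))⁻¹ =
      (√(2 * π))⁻¹ * ((2 * m + 1).factorial : ℝ)⁻¹ := by
    rw [← mul_inv, Real.mul_self_sqrt (hermiteNormSq_pos _).le, hermiteNormSq, mul_inv, mul_comm]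
  have hsign : ((-1 : ℝ) ^ m) * (-1) ^ m = 1 := by rw [← mul_pow]; simp
  have hf : ((2 * m + 1).factorial : ℝ) = (2 * m + 1) * (2 * m).factorial := by
    rw [Nat.factorial_succ]; push_cast; ring
  have hsq : √(N : ℝ) * √(N : ℝ) = N := Real.mul_self_sqrt hN'.le
  unfold hermiteFun
  rw [eval_realHermite_odd m hN, eval_realHermite_odd m hN]
  calc _ = ((√(hermiteNormSq (2 * m + 1)))⁻¹ * (√(hermiteNormSq (2 * m + 1)))⁻¹) *
        (exp (-((a / √N) ^ 2 / 4)) * exp (-((b / √N) ^ 2 / 4))) * (((-1 : ℝ) ^ m) * (-1) ^ m) *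
        (((2 * m + 1).factorial / (2 ^ m * m.factorial)) ^ 2) *
        (oddProfile N m a * oddProfile N m b) / (√(N : ℝ) * √(N : ℝ)) := by ring
    _ = _ := by
      rw [he, hn, hsign, hsq, centralProb, show (4 : ℝ) = 2 ^ 2 by norm_num, ← pow_mul,
        mul_comm 2 m, pow_mul, mul_comm m 2, hf]
      field_simp

theorem scaled_hermite_kernel_eq {N : ℕ} (hN : 0 < N) (a b : ℝ) :
    π / √N * familyKernel (fun k : Fin N => hermiteFun k) (a / √N) (b / √N) =
      exp (-((a ^ 2 + b ^ 2) / (4 * N))) * √(π / 2) *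
        ∫ u in (0 : ℝ)..1, √N * kernelTerm N a b ⌊(N : ℝ) * u⌋₊ := by
  have hN' : (0 : ℝ) < N := by exact_mod_cast hN
  have hsum : familyKernel (fun k : Fin N => hermiteFun k) (a / √N) (b / √N) =
      exp (-((a ^ 2 + b ^ 2) / (4 * N))) * (√(2 * π))⁻¹ *
        ∑ m ∈ Finset.range N, kernelTerm N a b m := by
    rw [familyKernel, Fin.sum_univ_eq_sum_range
      (fun k => hermiteFun k (a / √N) * hermiteFun k (b / √N)) N, sum_range_split_parity,
      Finset.mul_sum]
    refine Finset.sum_congr rfl fun m _ => ?_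
    rw [hermiteFun_mul_even m hN, hermiteFun_mul_odd m hN, kernelTerm]
    split_ifs <;> ring
  rw [hsum, ← integral_floor_mul, intervalIntegral.integral_const_mul]
  have h1 : π * (√(2 * π))⁻¹ = √(π / 2) := by
    rw [← div_eq_mul_inv, div_eq_iff (by positivity), ← Real.sqrt_mul (by positivity),
      show π / 2 * (2 * π) = π ^ 2 by ring, Real.sqrt_sq pi_pos.le]
  have h2 : (√(N : ℝ))⁻¹ * N = √N := by
    rw [inv_mul_eq_div, Real.div_sqrt]
  calc _ = exp (-((a ^ 2 + b ^ 2) / (4 * N))) * (π * (√(2 * π))⁻¹) * (((√(N : ℝ))⁻¹ * N) *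
        ∫ u in (0 : ℝ)..1, kernelTerm N a b ⌊(N : ℝ) * u⌋₊) := by ring
    _ = _ := by rw [h1, h2]

theorem floor_mul_le {N : ℕ} {u : ℝ} (h1 : u ≤ 1) : ⌊(N : ℝ) * u⌋₊ ≤ N := by
  refine Nat.floor_le_of_le ?_
  exact mul_le_of_le_one_right (Nat.cast_nonneg N) h1

theorem abs_sqrt_mul_kernelTerm_le {N : ℕ} (hN : 0 < N) {u : ℝ} (h0 : 0 < u) (h1 : u ≤ 1)
    {R a b : ℝ} (ha : |a| ≤ R) (hb : |b| ≤ R) :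
    |√N * kernelTerm N a b ⌊(N : ℝ) * u⌋₊| ≤
      √2 * u ^ (-(1 / 2) : ℝ) * ((1 + 3 * R ^ 2) * exp (2 * R ^ 2) ^ 2) := by
  have hN' : (0 : ℝ) < N := by exact_mod_cast hN
  have hR : 0 ≤ R := (abs_nonneg a).trans ha
  set m := ⌊(N : ℝ) * u⌋₊ with hmdef
  have hm : m ≤ N := floor_mul_le h1
  have hexp : ∀ c : ℝ, |c| ≤ R → exp (2 * c ^ 2) ≤ exp (2 * R ^ 2) := by
    intro c hc
    refine exp_le_exp.2 ?_
    have := sq_le_sq' (by linarith [abs_nonneg c]) hc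
    rw [sq_abs] at this
    linarith
  have he : ∀ c : ℝ, |c| ≤ R → |evenProfile N m c| ≤ exp (2 * R ^ 2) := fun c hc =>
    (abs_evenProfile_le hm c).trans (hexp c hc)
  have ho : ∀ c : ℝ, |c| ≤ R → |oddProfile N m c| ≤ R * exp (2 * R ^ 2) := fun c hc =>
    (abs_oddProfile_le hm c).trans (mul_le_mul hc (hexp c hc) (exp_pos _).le hR)
  have hcoef : (2 * (m : ℝ) + 1) / N ≤ 3 := by
    rw [div_le_iff₀ hN']
    have : 2 * m + 1 ≤ 3 * N := by omega
    exact_mod_cast this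
  have hE : |if 2 * m < N then evenProfile N m a * evenProfile N m b else 0| ≤
      exp (2 * R ^ 2) ^ 2 := by
    split_ifs
    · rw [abs_mul, sq]
      exact mul_le_mul (he a ha) (he b hb) (abs_nonneg _) (exp_pos _).le
    · simp; positivity
  have hO : |if 2 * m + 1 < N then (2 * (m : ℝ) + 1) / N * (oddProfile N m a * oddProfile N m b)
      else 0| ≤ 3 * R ^ 2 * exp (2 * R ^ 2) ^ 2 := by
    split_ifs
    · rw [abs_mul, abs_mul, abs_of_nonneg (by positivity : (0 : ℝ) ≤ (2 * m + 1) / N)]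
      calc _ ≤ 3 * ((R * exp (2 * R ^ 2)) * (R * exp (2 * R ^ 2))) :=
            mul_le_mul hcoef (mul_le_mul (ho a ha) (ho b hb) (abs_nonneg _) (by positivity))
              (by positivity) (by norm_num)
        _ = _ := by ring
    · simp; positivity
  rw [kernelTerm, ← mul_assoc, abs_mul,
    abs_of_nonneg (mul_nonneg (Real.sqrt_nonneg _) (centralProb_nonneg _))]
  refine mul_le_mul (sqrt_mul_centralProb_floor_le N h0) ?_ (abs_nonneg _) (by positivity)
  refine (abs_add_le _ _).trans ((add_le_add hE hO).trans (le_of_eq (by ring)))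

theorem integrable_inv_sqrt_const (C : ℝ) :
    IntervalIntegrable (fun u : ℝ => √2 * u ^ (-(1 / 2) : ℝ) * C) volume 0 1 :=
  ((intervalIntegral.intervalIntegrable_rpow' (by norm_num)).const_mul _).mul_const _

theorem exists_scaled_hermite_kernel_bound (R : ℝ) : ∃ C, 0 ≤ C ∧ ∀ N : ℕ, 0 < N → ∀ a b : ℝ,
    |a| ≤ R → |b| ≤ R →
      |π / √N * familyKernel (fun k : Fin N => hermiteFun k) (a / √N) (b / √N)| ≤ C := by
  refine ⟨√(π / 2) * |∫ u in (0 : ℝ)..1,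
    √2 * u ^ (-(1 / 2) : ℝ) * ((1 + 3 * R ^ 2) * exp (2 * R ^ 2) ^ 2)|, by positivity, ?_⟩
  intro N hN a b ha hb
  rw [scaled_hermite_kernel_eq hN, abs_mul, abs_mul, abs_of_pos (exp_pos _),
    abs_of_nonneg (Real.sqrt_nonneg _)]
  have h1 : exp (-((a ^ 2 + b ^ 2) / (4 * N))) ≤ 1 := by
    rw [exp_le_one_iff, neg_nonpos]; positivity
  have h2 : |∫ u in (0 : ℝ)..1, √N * kernelTerm N a b ⌊(N : ℝ) * u⌋₊| ≤
      |∫ u in (0 : ℝ)..1,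
        √2 * u ^ (-(1 / 2) : ℝ) * ((1 + 3 * R ^ 2) * exp (2 * R ^ 2) ^ 2)| := by
    refine intervalIntegral.norm_integral_le_abs_of_norm_le (E := ℝ)
      (f := fun u => √N * kernelTerm N a b ⌊(N : ℝ) * u⌋₊) ?_ (integrable_inv_sqrt_const _)
    rw [Set.uIoc_of_le zero_le_one]
    refine (ae_restrict_mem measurableSet_Ioc).mono fun u hu => ?_
    exact abs_sqrt_mul_kernelTerm_le hN hu.1 hu.2 ha hb
  refine (mul_le_mul_of_nonneg_right
    (mul_le_of_le_one_left (Real.sqrt_nonneg _) h1) (abs_nonneg _)).trans ?_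
  exact mul_le_mul_of_nonneg_left h2 (Real.sqrt_nonneg _)

theorem integral_cos_sqrt (d : ℝ) :
    ∫ u in (0 : ℝ)..(1 / 2), (√(2 * u))⁻¹ * cos (√(2 * u) * (π * d)) =
      if d = 0 then 1 else sin (π * d) / (π * d) := by
  have hder : ∀ u ∈ Set.Ioo (0 : ℝ) (1 / 2), HasDerivAt (fun u : ℝ => √(2 * u)) (√(2 * u))⁻¹ u := by
    intro u hu
    have h1 : HasDerivAt (fun u : ℝ => 2 * u) 2 u := by
      simpa using (hasDerivAt_id u).const_mul 2
    have h2 := h1.sqrt (by linarith [hu.1])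
    refine h2.congr_deriv ?_
    have : 0 < √(2 * u) := Real.sqrt_pos.2 (by linarith [hu.1])
    field_simp
  have hinteg : IntervalIntegrable (fun u : ℝ => (√(2 * u))⁻¹ * cos (√(2 * u) * (π * d)))
      volume 0 (1 / 2) := by
    refine IntervalIntegrable.mul_continuousOn ?_ (by fun_prop)
    have h : IntervalIntegrable (fun u : ℝ => (√2)⁻¹ * u ^ (-(1 / 2) : ℝ)) volume 0 (1 / 2) :=
      (intervalIntegral.intervalIntegrable_rpow' (by norm_num)).const_mul _
    refine h.congr fun u hu => ?_
    rw [Set.uIoc_of_le (by norm_num)] at hu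
    rw [Real.sqrt_mul (by norm_num), mul_inv, Real.rpow_neg hu.1.le, ← Real.sqrt_eq_rpow]
  split_ifs with hd
  · subst hd
    rw [intervalIntegral.integral_eq_sub_of_hasDerivAt_of_le (f := fun u => √(2 * u))
      (by norm_num) (by fun_prop) _ hinteg]
    · norm_num
    · intro u hu
      refine (hder u hu).congr_deriv (by simp)
  · have hpd : π * d ≠ 0 := mul_ne_zero pi_ne_zero hd
    rw [intervalIntegral.integral_eq_sub_of_hasDerivAt_of_le
      (f := fun u => sin (√(2 * u) * (π * d)) / (π * d))
      (by norm_num) (by fun_prop) _ hinteg]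
    · norm_num
    · intro u hu
      have := (((hder u hu).mul_const (π * d)).sin).div_const (π * d)
      refine this.congr_deriv ?_
      field_simp

theorem Ksine_eq (s t : ℝ) : Ksine s t =
    if s - t = 0 then 1 else sin (π * (s - t)) / (π * (s - t)) := by
  simp only [Ksine, sub_eq_zero]

theorem tendsto_sqrt_mul_kernelTerm {u : ℝ} (h0 : 0 < u) (h1 : u ≤ 1) (h2 : u ≠ 1 / 2)
    (s t : ℝ) :
    Tendsto (fun N : ℕ => √N * kernelTerm N (π * s) (π * t) ⌊(N : ℝ) * u⌋₊) atTop
      (𝓝 ((Set.Iic (1 / 2 : ℝ)).indicator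
        (fun u => √(1 / (π * u)) * cos (√(2 * u) * (π * (s - t)))) u)) := by
  have hfl := tendsto_floor_div h0.le
  have hm : ∀ N : ℕ, ⌊(N : ℝ) * u⌋₊ ≤ N := fun N => floor_mul_le h1
  have hb := tendsto_sqrt_mul_centralProb h0
  have hcoef : Tendsto (fun N : ℕ => (2 * (⌊(N : ℝ) * u⌋₊ : ℝ) + 1) / N) atTop (𝓝 (2 * u)) := by
    have := ((hfl.const_mul 2).add (tendsto_const_div_atTop_nhds_zero_nat 1))
    rw [add_zero] at this
    refine this.congr fun N => ?_
    ring
  rcases lt_or_gt_of_ne h2 with hu | hu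
  · have hE := (tendsto_evenProfile h0.le hm hfl (π * s)).mul
      (tendsto_evenProfile h0.le hm hfl (π * t))
    have hO := hcoef.mul ((tendsto_oddProfile h0 hm hfl (π * s)).mul
      (tendsto_oddProfile h0 hm hfl (π * t)))
    have hlim := hb.mul (hE.add hO)
    have hval : √(1 / (π * u)) * (cos (√(2 * u) * (π * s)) * cos (√(2 * u) * (π * t)) +
        2 * u * (sin (√(2 * u) * (π * s)) / √(2 * u) * (sin (√(2 * u) * (π * t)) / √(2 * u)))) =
        (Set.Iic (1 / 2 : ℝ)).indicator
        (fun u => √(1 / (π * u)) * cos (√(2 * u) * (π * (s - t)))) u := by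
      rw [Set.indicator_of_mem (Set.mem_Iic.2 hu.le), show √(2 * u) * (π * (s - t)) =
        √(2 * u) * (π * s) - √(2 * u) * (π * t) by ring, cos_sub, div_mul_div_comm,
        Real.mul_self_sqrt (by positivity), mul_div_cancel₀ _ (by positivity)]
    rw [hval] at hlim
    refine hlim.congr' ?_
    have hev : ∀ᶠ N : ℕ in atTop, (2 * (⌊(N : ℝ) * u⌋₊ : ℝ) + 1) / N < 1 :=
      hcoef.eventually_lt_const (by linarith)
    filter_upwards [hev, eventually_gt_atTop 0] with N hN hpos
    have hN' : (0 : ℝ) < N := by exact_mod_cast hpos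
    rw [div_lt_one hN'] at hN
    have hlt : 2 * ⌊(N : ℝ) * u⌋₊ + 1 < N := by exact_mod_cast hN
    rw [kernelTerm, if_pos (by omega), if_pos hlt]
    ring
  · rw [Set.indicator_of_notMem (by simpa using hu)]
    refine tendsto_const_nhds.congr' ?_
    have hev : ∀ᶠ N : ℕ in atTop, 1 < 2 * ((⌊(N : ℝ) * u⌋₊ : ℝ) / N) :=
      (hfl.const_mul 2).eventually_const_lt (by linarith)
    filter_upwards [hev, eventually_gt_atTop 0] with N hN hpos
    have hN' : (0 : ℝ) < N := by exact_mod_cast hpos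
    rw [← mul_div_assoc, one_lt_div hN'] at hN
    have hlt : N < 2 * ⌊(N : ℝ) * u⌋₊ := by exact_mod_cast hN
    rw [kernelTerm, if_neg (by omega), if_neg (by omega)]
    simp

theorem tendsto_scaled_hermite_kernel (s t : ℝ) :
    Tendsto (fun N : ℕ => π / √N * familyKernel (fun k : Fin N => hermiteFun k)
      (π * s / √N) (π * t / √N)) atTop (𝓝 (Ksine s t)) := by
  have hexp : Tendsto (fun N : ℕ => exp (-(((π * s) ^ 2 + (π * t) ^ 2) / (4 * N)))) atTop
      (𝓝 1) := by
    have h : Tendsto (fun N : ℕ => -((((π * s) ^ 2 + (π * t) ^ 2) / 4) / N)) atTop (𝓝 (-0)) :=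
      (tendsto_const_div_atTop_nhds_zero_nat _).neg
    have := (continuous_exp.tendsto _).comp h
    rw [neg_zero, exp_zero] at this
    refine this.congr fun N => ?_
    simp only [Function.comp, div_div]
  set R := max |π * s| |π * t|
  have hinteg : Tendsto (fun N : ℕ => ∫ u in (0 : ℝ)..1,
      √N * kernelTerm N (π * s) (π * t) ⌊(N : ℝ) * u⌋₊) atTop
      (𝓝 (∫ u in (0 : ℝ)..1, (Set.Iic (1 / 2 : ℝ)).indicator
        (fun u => √(1 / (π * u)) * cos (√(2 * u) * (π * (s - t)))) u)) := by
    refine intervalIntegral.tendsto_integral_filter_of_dominated_convergence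
      (fun u => √2 * u ^ (-(1 / 2) : ℝ) * ((1 + 3 * R ^ 2) * exp (2 * R ^ 2) ^ 2)) ?_ ?_
      (integrable_inv_sqrt_const _) ?_
    · refine Eventually.of_forall fun N => ?_
      have : Measurable fun u : ℝ => kernelTerm N (π * s) (π * t) ⌊(N : ℝ) * u⌋₊ :=
        (measurable_from_nat (f := kernelTerm N (π * s) (π * t))).comp (Nat.measurable_floor.comp (measurable_const_mul _))
      exact (this.const_mul _).aestronglyMeasurable
    · filter_upwards [eventually_gt_atTop 0] with N hN
      refine Eventually.of_forall fun u hu => ?_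
      rw [Set.uIoc_of_le zero_le_one] at hu
      exact abs_sqrt_mul_kernelTerm_le hN hu.1 hu.2 (le_max_left _ _) (le_max_right _ _)
    · have hne : ∀ᵐ u : ℝ, u ≠ 1 / 2 := by simp [ae_iff]
      filter_upwards [hne] with u hu hmem
      rw [Set.uIoc_of_le zero_le_one] at hmem
      exact tendsto_sqrt_mul_kernelTerm hmem.1 hmem.2 hu s t
  have hval : √(π / 2) * ∫ u in (0 : ℝ)..1, (Set.Iic (1 / 2 : ℝ)).indicator
        (fun u => √(1 / (π * u)) * cos (√(2 * u) * (π * (s - t)))) u = Ksine s t := by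
    have hset : (Set.Iic (1 / 2 : ℝ)) = {x | x ≤ 1 / 2} := rfl
    have hmem : (1 / 2 : ℝ) ∈ Set.Icc (0 : ℝ) 1 := by norm_num
    rw [hset, intervalIntegral.integral_indicator hmem, Ksine_eq, ← integral_cos_sqrt,
      ← intervalIntegral.integral_const_mul]
    refine intervalIntegral.integral_congr fun u hu => ?_
    rw [Set.uIcc_of_le (by norm_num)] at hu
    rw [← mul_assoc, ← Real.sqrt_mul (by positivity), ← Real.sqrt_inv]
    congr 2
    have := pi_pos
    field_simp
  have := (hexp.mul_const (√(π / 2))).mul hinteg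
  rw [one_mul, hval] at this
  refine this.congr' ?_
  filter_upwards [eventually_gt_atTop 0] with N hN
  rw [scaled_hermite_kernel_eq hN]

/-- The radial profile `u ↦ u e^{(1 - u²)/2}`, maximal at `u = 1`. -/
noncomputable def radialProfile (u : ℝ) : ℝ := u * exp ((1 - u ^ 2) / 2)

theorem continuous_radialProfile : Continuous radialProfile := by
  unfold radialProfile
  fun_prop

theorem integral_radial_weight {N : ℕ} (hN : 0 < N) {q : ℝ} (hq : 0 ≤ q) :
    IntegrableOn (fun u : ℝ => {u : ℝ | q ≤ (N * u) ^ 2}.indicator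
      (fun u => (N : ℝ) ^ 2 * u * exp (-((N * u) ^ 2 / 2))) u) (Set.Ioi 0) ∧
    ∫ u in Set.Ioi (0 : ℝ), {u : ℝ | q ≤ (N * u) ^ 2}.indicator
      (fun u => (N : ℝ) ^ 2 * u * exp (-((N * u) ^ 2 / 2))) u = exp (-(q / 2)) := by
  have hN' : (0 : ℝ) < N := by exact_mod_cast hN
  set k : ℝ → ℝ := fun u => (N : ℝ) ^ 2 * u * exp (-((N * u) ^ 2 / 2)) with hk
  set a : ℝ := √q / N with ha
  have ha0 : 0 ≤ a := by positivity
  have hmeas : MeasurableSet {u : ℝ | q ≤ (N * u) ^ 2} :=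
    measurableSet_le measurable_const (by fun_prop)
  have hset : (Set.Ioi (0 : ℝ) ∩ {u : ℝ | q ≤ (N * u) ^ 2} : Set ℝ) =ᵐ[volume] Set.Ioi a := by
    have h1 : Set.Ioi (0 : ℝ) ∩ {u : ℝ | q ≤ (N * u) ^ 2} = Set.Ioi 0 ∩ Set.Ici a := by
      ext u
      simp only [Set.mem_inter_iff, Set.mem_Ioi, Set.mem_ofPred_eq, Set.mem_Ici]
      refine and_congr_right fun hu => ?_
      rw [ha, div_le_iff₀ hN', mul_comm u, ← Real.sqrt_le_left (by positivity)]
    have h2 : Set.Ioi a = Set.Ioi 0 ∩ Set.Ioi a := by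
      rw [Set.Ioi_inter_Ioi, sup_eq_right.2 ha0]
    rw [h1, h2]
    exact (ae_eq_refl _).inter Ioi_ae_eq_Ici.symm
  have hder : ∀ u : ℝ, HasDerivAt (fun u : ℝ => -exp (-((N * u) ^ 2 / 2))) (k u) u := by
    intro u
    have h1 : HasDerivAt (fun u : ℝ => -(((N : ℝ) * u) ^ 2 / 2)) (-((N : ℝ) ^ 2 * u)) u := by
      have := (((hasDerivAt_id u).const_mul (N : ℝ)).pow 2).div_const 2 |>.neg
      refine this.congr_deriv ?_
      simp; ring
    refine h1.exp.neg.congr_deriv ?_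
    simp only [hk]; ring
  have hlim : Tendsto (fun u : ℝ => -exp (-((N * u) ^ 2 / 2))) atTop (𝓝 0) := by
    have h : Tendsto (fun u : ℝ => ((N : ℝ) * u) ^ 2 / 2) atTop atTop :=
      ((tendsto_pow_atTop two_ne_zero).comp (tendsto_id.const_mul_atTop hN')).atTop_div_const
        (by norm_num)
    simpa using ((tendsto_exp_neg_atTop_nhds_zero).comp h).neg
  have hpos : ∀ u ∈ Set.Ioi a, 0 ≤ k u := fun u hu => by
    have : 0 ≤ u := ha0.trans (le_of_lt hu)
    positivity
  have hval : exp (-(q / 2)) = 0 - -exp (-((N * a) ^ 2 / 2)) := by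
    rw [ha, mul_div_cancel₀ _ hN'.ne', Real.sq_sqrt hq]; ring
  constructor
  · rw [integrableOn_indicator_iff hmeas, Set.inter_comm]
    refine IntegrableOn.congr_set_ae ?_ hset
    exact integrableOn_Ioi_deriv_of_nonneg' (fun u _ => hder u) hpos hlim
  · rw [setIntegral_indicator hmeas, setIntegral_congr_set hset, hval]
    exact integral_Ioi_of_hasDerivAt_of_nonneg' (fun u _ => hder u) hpos hlim

/-- The closed Euclidean ball of radius `r` as a set of coordinate vectors. -/
def traceBall (N : ℕ) (r : ℝ) : Set (Fin N → ℝ) := {z | ∑ i, z i ^ 2 ≤ r ^ 2}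

theorem isClosed_traceBall (N : ℕ) (r : ℝ) : IsClosed (traceBall N r) :=
  isClosed_le (by fun_prop) continuous_const

theorem smul_mem_traceBall_iff {N : ℕ} {c r : ℝ} (hc : 0 < c) (x : Fin N → ℝ) :
    c • x ∈ traceBall N (c * r) ↔ x ∈ traceBall N r := by
  simp only [traceBall, Set.mem_ofPred_eq, Pi.smul_apply, smul_eq_mul, mul_pow, ← Finset.mul_sum]
  exact mul_le_mul_iff_right₀ (by positivity)

/-- The integral of `h` over the ball of radius `r` against the squared Vandermonde weight. -/
noncomputable def ballIntegral (N : ℕ) (r : ℝ) (h : (Fin N → ℝ) → ℝ) : ℝ :=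
  ∫ x, (traceBall N r).indicator (fun x => h x * vand 2 N x) x

theorem ballIntegral_mul_radius {N : ℕ} {c : ℝ} (hc : 0 < c) (r : ℝ) (h : (Fin N → ℝ) → ℝ) :
    ballIntegral N (c * r) h = c ^ (N ^ 2) * ballIntegral N r (fun x => h (c • x)) := by
  have key := Measure.integral_comp_smul (volume : Measure (Fin N → ℝ))
    ((traceBall N (c * r)).indicator (fun x => h x * vand 2 N x)) c
  have hpt : ∀ x : Fin N → ℝ, (traceBall N (c * r)).indicator (fun x => h x * vand 2 N x) (c • x) =
      c ^ (N * (N - 1)) * (traceBall N r).indicator (fun x => h (c • x) * vand 2 N x) x := by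
    intro x
    by_cases hx : x ∈ traceBall N r
    · rw [Set.indicator_of_mem hx, Set.indicator_of_mem ((smul_mem_traceBall_iff hc x).2 hx),
        vand_two_smul]
      ring
    · rw [Set.indicator_of_notMem hx,
        Set.indicator_of_notMem (fun h' => hx ((smul_mem_traceBall_iff hc x).1 h')), mul_zero]
  simp only [hpt, integral_const_mul, Module.finrank_fintype_fun_eq_card, Fintype.card_fin,
    smul_eq_mul] at key
  rw [abs_of_pos (by positivity), eq_inv_mul_iff_mul_eq₀ (by positivity)] at key
  rw [ballIntegral, ← key, ← mul_assoc, ← pow_add, ballIntegral]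
  congr 2
  cases N with
  | zero => rfl
  | succ N => simp; ring

/-- The reindexing underlying `combine`. -/
def combineEquiv {n N : ℕ} (h : n ≤ N) : Fin n ⊕ Fin (N - n) ≃ Fin N :=
  finSumFinEquiv.trans (finCongr (by omega))

theorem combine_comp_combineEquiv {n N : ℕ} (h : n ≤ N) (x : Fin n → ℝ) (y : Fin (N - n) → ℝ) :
    combine N n x y ∘ combineEquiv h = Sum.elim x y := by
  funext i
  rcases i with i | i
  · simp [combine, combineEquiv]
  · simp [combine, combineEquiv]

theorem combine_castLE {n N : ℕ} (h : n ≤ N) (x : Fin n → ℝ) (y : Fin (N - n) → ℝ) :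
    combine N n x y ∘ Fin.castLE h = x := by
  funext i
  simp [combine]

theorem combine_zero {N : ℕ} (x : Fin 0 → ℝ) (y : Fin (N - 0) → ℝ) : combine N 0 x y = y := by
  funext i
  simp [combine]

theorem exists_measurableEquiv_combine {n N : ℕ} (h : n ≤ N) :
    ∃ e : (Fin n → ℝ) × (Fin (N - n) → ℝ) ≃ᵐ (Fin N → ℝ),
      MeasurePreserving e ∧ ∀ p, e p = combine N n p.1 p.2 := by
  refine ⟨(MeasurableEquiv.sumPiEquivProdPi (fun _ => ℝ)).symm.trans
    (MeasurableEquiv.piCongrLeft (fun _ => ℝ) (combineEquiv h)), ?_, ?_⟩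
  · exact (volume_measurePreserving_sumPiEquivProdPi_symm (fun _ => ℝ)).trans
      (volume_measurePreserving_piCongrLeft (fun _ => ℝ) (combineEquiv h))
  · intro p
    refine (combineEquiv h).surjective.injective_comp_right ?_
    change _ ∘ combineEquiv h = combine N n p.1 p.2 ∘ combineEquiv h
    rw [combine_comp_combineEquiv]
    funext i
    rcases i with i | i
    · exact Equiv.piCongrLeft_apply_apply (fun _ => ℝ) (combineEquiv h) _ (Sum.inl i)
    · exact Equiv.piCongrLeft_apply_apply (fun _ => ℝ) (combineEquiv h) _ (Sum.inr i)

theorem integral_eq_integral_combine {n N : ℕ} (h : n ≤ N) {H : (Fin N → ℝ) → ℝ}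
    (hH : Integrable H) : ∫ z, H z = ∫ x : Fin n → ℝ, ∫ y, H (combine N n x y) := by
  obtain ⟨e, he, hval⟩ := exists_measurableEquiv_combine h
  have hinteg : Integrable (fun p : (Fin n → ℝ) × (Fin (N - n) → ℝ) => H (combine N n p.1 p.2))
      (volume.prod volume) := by
    simp_rw [← hval]
    exact (he.integrable_comp_emb e.measurableEmbedding).2 hH
  rw [← he.integral_comp e.measurableEmbedding, Measure.volume_eq_prod]
  simp_rw [hval]
  exact integral_prod _ hinteg

theorem continuous_combine {n N : ℕ} (x : Fin n → ℝ) : Continuous (combine N n x) := by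
  refine continuous_pi fun i => ?_
  unfold combine
  split_ifs <;> fun_prop

theorem OrthonormalFamily.integrable_kernelDet_combine {n N : ℕ} (h : n ≤ N)
    {φ : Fin N → ℝ → ℝ} (hφ : OrthonormalFamily φ) (hc : ∀ k, Continuous (φ k)) (x : Fin n → ℝ) :
    Integrable (fun y => kernelDet φ (combine N n x y)) ∧
      ∫ y, kernelDet φ (combine N n x y) = (N - n).factorial * kernelDet φ x := by
  have hl := hφ.lintegral_kernelDet (N - n) x (by simp; omega)
  simp_rw [← combine_comp_combineEquiv h, kernelDet_comp_equiv] at hl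
  have hm : AEStronglyMeasurable (fun y => kernelDet φ (combine N n x y)) :=
    ((continuous_kernelDet hc).comp (continuous_combine x)).aestronglyMeasurable
  have hnn : ∀ y, 0 ≤ kernelDet φ (combine N n x y) := fun y => kernelDet_nonneg _ _
  refine ⟨⟨hm, ?_⟩, ?_⟩
  · rw [hasFiniteIntegral_iff_ofReal (Eventually.of_forall hnn), hl]
    exact ENNReal.ofReal_lt_top
  · rw [integral_eq_lintegral_of_nonneg_ae (Eventually.of_forall hnn) hm, hl,
      ENNReal.toReal_ofReal (mul_nonneg (Nat.cast_nonneg _) (kernelDet_nonneg _ _))]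

/-- The eigenvalue weight of the Gaussian unitary ensemble with unit variance. -/
noncomputable def gaussianWeight (N : ℕ) (x : Fin N → ℝ) : ℝ :=
  vand 2 N x * exp (-((∑ i, x i ^ 2) / 2))

theorem gaussianWeight_eq {N : ℕ} (x : Fin N → ℝ) : gaussianWeight N x =
    (∏ k : Fin N, hermiteNormSq k) * kernelDet (fun k : Fin N => hermiteFun k) x :=
  vand_two_mul_gaussian x

theorem integrable_gaussianWeight (N : ℕ) : Integrable (gaussianWeight N) := by
  have h := ((orthonormalFamily_hermiteFun N).integrable_kernelDet_combine (Nat.zero_le N)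
    (fun k => continuous_hermiteFun k) Fin.elim0).1
  simp only [combine_zero] at h
  simpa only [← gaussianWeight_eq] using h.const_mul (∏ k : Fin N, hermiteNormSq k)

theorem integral_gaussianWeight (N : ℕ) :
    ∫ x, gaussianWeight N x = N.factorial * ∏ k : Fin N, hermiteNormSq k := by
  have h := ((orthonormalFamily_hermiteFun N).integrable_kernelDet_combine (Nat.zero_le N)
    (fun k => continuous_hermiteFun k) Fin.elim0).2
  simp only [combine_zero, Nat.sub_zero] at h
  simp only [gaussianWeight_eq, integral_const_mul, mul_comm (N.factorial : ℝ)]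
  erw [h]
  simp [kernelDet]

theorem integral_gaussianWeight_pos (N : ℕ) : 0 < ∫ x, gaussianWeight N x := by
  rw [integral_gaussianWeight]
  exact mul_pos (by positivity) (Finset.prod_pos fun k _ => hermiteNormSq_pos k)

theorem integrable_mul_gaussianWeight {N : ℕ} {h : (Fin N → ℝ) → ℝ} (hc : Continuous h) {B : ℝ}
    (hB : ∀ x, |h x| ≤ B) : Integrable fun x => h x * gaussianWeight N x :=
  (integrable_gaussianWeight N).bdd_mul hc.aestronglyMeasurable (Eventually.of_forall hB)

/-- Integrals of statistics of the first `n` eigenvalues of the Gaussian unitary ensemble are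
integrals against the determinant of the rescaled Hermite kernel. -/
theorem gaussian_correlation {n N : ℕ} (hN : 0 < N) (h : n ≤ N) {g : (Fin n → ℝ) → ℝ}
    (hg : Continuous g) {B : ℝ} (hB : ∀ t, |g t| ≤ B) :
    (N.factorial : ℝ) / (N - n).factorial * (∫ x, gaussianWeight N x)⁻¹ *
      ∫ x, g ((√N / π) • (x ∘ Fin.castLE h)) * gaussianWeight N x =
    ∫ t, g t * Matrix.det (Matrix.of fun i j : Fin n =>
      π / √N * familyKernel (fun k : Fin N => hermiteFun k) (π * t i / √N) (π * t j / √N)) := by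
  have hs : 0 < √(N : ℝ) := Real.sqrt_pos.2 (by exact_mod_cast hN)
  have hH : 0 < ∏ k : Fin N, hermiteNormSq k := Finset.prod_pos fun k _ => hermiteNormSq_pos k
  have hinteg : Integrable fun x : Fin N → ℝ =>
      g ((√N / π) • (x ∘ Fin.castLE h)) * gaussianWeight N x :=
    integrable_mul_gaussianWeight (h := fun x => g ((√N / π) • (x ∘ Fin.castLE h)))
      (hg.comp (by fun_prop)) fun x => hB _
  have hdet : ∀ t : Fin n → ℝ, Matrix.det (Matrix.of fun i j : Fin n =>
      π / √N * familyKernel (fun k : Fin N => hermiteFun k) (π * t i / √N) (π * t j / √N)) =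
      (π / √N) ^ n * kernelDet (fun k : Fin N => hermiteFun k) ((π / √N) • t) := by
    intro t
    have : (Matrix.of fun i j : Fin n =>
      π / √N * familyKernel (fun k : Fin N => hermiteFun k) (π * t i / √N) (π * t j / √N)) =
      (π / √N) • (Matrix.of fun i j : Fin n => familyKernel (fun k : Fin N => hermiteFun k)
        (((π / √N) • t) i) (((π / √N) • t) j)) := by
      ext i j
      simp [div_mul_eq_mul_div]
    rw [this, Matrix.det_smul, Fintype.card_fin, kernelDet]
  rw [integral_gaussianWeight, integral_eq_integral_combine h hinteg]
  simp_rw [combine_castLE, integral_const_mul, gaussianWeight_eq, integral_const_mul,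
    ((orthonormalFamily_hermiteFun N).integrable_kernelDet_combine h
      (fun k => continuous_hermiteFun k) _).2, hdet]
  have hscale := Measure.integral_comp_smul (volume : Measure (Fin n → ℝ))
    (fun x => g ((√N / π) • x) * kernelDet (fun k : Fin N => hermiteFun k) x) (π / √N)
  simp only [smul_smul, div_mul_div_cancel₀' hs.ne', div_self pi_ne_zero, one_smul,
    Module.finrank_fintype_fun_eq_card, Fintype.card_fin, smul_eq_mul] at hscale
  rw [abs_of_pos (by positivity), eq_inv_mul_iff_mul_eq₀ (by positivity)] at hscale
  have hl : ∀ x : Fin n → ℝ, g ((√N / π) • x) * ((∏ k : Fin N, hermiteNormSq k) *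
      ((N - n).factorial * kernelDet (fun k : Fin N => hermiteFun k) x)) =
      ((∏ k : Fin N, hermiteNormSq k) * (N - n).factorial) *
        (g ((√N / π) • x) * kernelDet (fun k : Fin N => hermiteFun k) x) := fun x => by ring
  have hr : ∀ t : Fin n → ℝ, g t * ((π / √N) ^ n *
      kernelDet (fun k : Fin N => hermiteFun k) ((π / √N) • t)) =
      (π / √N) ^ n * (g t * kernelDet (fun k : Fin N => hermiteFun k) ((π / √N) • t)) :=
    fun t => by ring
  simp_rw [hl, hr, integral_const_mul]
  rw [hscale]
  have : ((N - n).factorial : ℝ) ≠ 0 := by positivity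
  have : (N.factorial : ℝ) ≠ 0 := by positivity
  field_simp

theorem tendsto_integral_det_hermite_kernel {n : ℕ} {g : (Fin n → ℝ) → ℝ} (hg : Continuous g)
    (hsupp : HasCompactSupport g) :
    Tendsto (fun N : ℕ => ∫ t, g t * Matrix.det (Matrix.of fun i j : Fin n =>
      π / √N * familyKernel (fun k : Fin N => hermiteFun k) (π * t i / √N) (π * t j / √N))) atTop
      (𝓝 (∫ t, g t * Matrix.det (Matrix.of fun j k : Fin n => Ksine (t j) (t k)))) := by
  obtain ⟨R, hR⟩ := hsupp.isCompact.isBounded.exists_norm_le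
  obtain ⟨C, hC0, hC⟩ := exists_scaled_hermite_kernel_bound (π * R)
  refine tendsto_integral_filter_of_dominated_convergence
    (fun t => |g t| * (n.factorial • C ^ n)) ?_ ?_ ?_ ?_
  · refine Eventually.of_forall fun N => Continuous.aestronglyMeasurable (hg.mul ?_)
    refine Continuous.matrix_det (continuous_matrix fun i j => ?_)
    have hk : ∀ k : ℕ, Continuous (hermiteFun k) := continuous_hermiteFun
    simp only [Matrix.of_apply, familyKernel]
    fun_prop
  · filter_upwards [eventually_gt_atTop 0] with N hN
    refine Eventually.of_forall fun t => ?_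
    by_cases ht : g t = 0
    · simp [ht]
    have htR : ∀ i, |π * t i| ≤ π * R := by
      intro i
      rw [abs_mul, abs_of_pos pi_pos]
      refine mul_le_mul_of_nonneg_left ?_ pi_pos.le
      exact (norm_le_pi_norm t i).trans (hR t (subset_tsupport g ht))
    rw [norm_mul, Real.norm_eq_abs]
    refine mul_le_mul_of_nonneg_left ?_ (abs_nonneg _)
    have := Matrix.det_le (abv := IsAbsoluteValue.toAbsoluteValue (abs : ℝ → ℝ))
      (x := C) (A := Matrix.of fun i j : Fin n =>
      π / √N * familyKernel (fun k : Fin N => hermiteFun k) (π * t i / √N) (π * t j / √N))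
      fun i j => hC N hN _ _ (htR i) (htR j)
    simpa using this
  · exact (hg.integrable_of_hasCompactSupport hsupp).abs.mul_const _
  · refine Eventually.of_forall fun t => Tendsto.const_mul _ ?_
    have hdet : Continuous fun M : Matrix (Fin n) (Fin n) ℝ => M.det := continuous_id.matrix_det
    refine (hdet.tendsto _).comp ?_
    refine tendsto_pi_nhds.2 fun i => tendsto_pi_nhds.2 fun j => ?_
    exact tendsto_scaled_hermite_kernel (t i) (t j)

theorem integrableOn_mixture_and_eq {N : ℕ} (hN : 0 < N) {h : (Fin N → ℝ) → ℝ}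
    (hc : Continuous h) {B : ℝ} (hB : ∀ x, |h x| ≤ B) :
    IntegrableOn (fun u => u * radialProfile u ^ (N ^ 2) * ballIntegral N N (fun x => h (u • x)))
      (Set.Ioi 0) ∧
    ∫ x, h x * gaussianWeight N x = (N : ℝ) ^ 2 * exp (-((N : ℝ) ^ 2 / 2)) *
      ∫ u in Set.Ioi (0 : ℝ),
        u * radialProfile u ^ (N ^ 2) * ballIntegral N N (fun x => h (u • x)) := by
  have hN' : (0 : ℝ) < N := by exact_mod_cast hN
  set k : ℝ → ℝ := fun u => (N : ℝ) ^ 2 * u * exp (-((N * u) ^ 2 / 2)) with hk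
  set q : (Fin N → ℝ) → ℝ := fun x => ∑ i, x i ^ 2 with hq
  have hq0 : ∀ x, 0 ≤ q x := fun x => Finset.sum_nonneg fun i _ => sq_nonneg _
  have hqc : Continuous q := by fun_prop
  have hkc : Continuous k := by fun_prop
  set μ : Measure ℝ := volume.restrict (Set.Ioi 0) with hμ
  set F : (Fin N → ℝ) → ℝ → ℝ := fun x u =>
    h x * vand 2 N x * {u : ℝ | q x ≤ (N * u) ^ 2}.indicator k u with hF
  have hFeq : Function.uncurry F = {p : (Fin N → ℝ) × ℝ | q p.1 ≤ (N * p.2) ^ 2}.indicator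
      fun p => h p.1 * vand 2 N p.1 * k p.2 := by
    funext p
    simp only [Function.uncurry, hF, Set.indicator_apply, Set.mem_ofPred_eq, mul_ite, mul_zero]
  have hV := continuous_vand_two N
  have hFm : AEStronglyMeasurable (Function.uncurry F) (volume.prod μ) := by
    rw [hFeq]
    refine AEStronglyMeasurable.indicator (Continuous.aestronglyMeasurable (by fun_prop)) ?_
    exact (isClosed_le (by fun_prop) (by fun_prop)).measurableSet
  have hknn : ∀ x, ∀ u ∈ Set.Ioi (0 : ℝ), 0 ≤ {u : ℝ | q x ≤ (N * u) ^ 2}.indicator k u := by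
    intro x u hu
    refine Set.indicator_apply_nonneg fun _ => ?_
    have : (0 : ℝ) < u := hu
    positivity
  have hnorm : ∀ x, ∫ u, ‖F x u‖ ∂μ = |h x| * gaussianWeight N x := by
    intro x
    rw [gaussianWeight, ← (integral_radial_weight hN (hq0 x)).2, ← mul_assoc,
      ← integral_const_mul]
    refine setIntegral_congr_fun measurableSet_Ioi fun u hu => ?_
    simp only [hF, norm_mul, Real.norm_eq_abs, abs_of_nonneg (hknn x u hu),
      abs_of_nonneg (vand_two_nonneg x)]
    rfl
  have hFi : Integrable (Function.uncurry F) (volume.prod μ) := by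
    rw [integrable_prod_iff hFm]
    refine ⟨Eventually.of_forall fun x => (integral_radial_weight hN (hq0 x)).1.const_mul
      (h x * vand 2 N x), ?_⟩
    simp only [Function.uncurry, hnorm]
    exact integrable_mul_gaussianWeight hc.abs fun x => by simpa using hB x
  have hinner : ∀ u ∈ Set.Ioi (0 : ℝ), ∫ x, F x u = (N : ℝ) ^ 2 * exp (-((N : ℝ) ^ 2 / 2)) *
      (u * radialProfile u ^ (N ^ 2) * ballIntegral N N (fun x => h (u • x))) := by
    intro u hu
    have h1 : ∀ x, F x u = k u * (traceBall N (u * N)).indicator (fun x => h x * vand 2 N x) x := by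
      intro x
      simp only [hF, Set.indicator_apply, traceBall, Set.mem_ofPred_eq, mul_comm u, hq]
      split_ifs <;> ring
    simp_rw [h1, integral_const_mul]
    rw [← ballIntegral, ballIntegral_mul_radius hu, hk, radialProfile, mul_pow, ← exp_nat_mul]
    have h2 : exp (-((N * u) ^ 2 / 2)) = exp (-((N : ℝ) ^ 2 / 2)) *
        exp (((N ^ 2 : ℕ) : ℝ) * ((1 - u ^ 2) / 2)) := by
      rw [← exp_add]; congr 1; push_cast; ring
    simp only [h2]
    ring
  have hconst : (N : ℝ) ^ 2 * exp (-((N : ℝ) ^ 2 / 2)) ≠ 0 := by positivity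
  constructor
  · have h1 := hFi.integral_prod_right
    have h2 : IntegrableOn (fun u => (N : ℝ) ^ 2 * exp (-((N : ℝ) ^ 2 / 2)) *
      (u * radialProfile u ^ (N ^ 2) * ballIntegral N N (fun x => h (u • x)))) (Set.Ioi 0) :=
      IntegrableOn.congr_fun h1 hinner measurableSet_Ioi
    exact (integrable_const_mul_iff (isUnit_iff_ne_zero.2 hconst) _).1 h2
  · rw [← integral_const_mul, ← setIntegral_congr_fun measurableSet_Ioi hinner]
    rw [← integral_integral_swap hFi]
    refine integral_congr_ae (Eventually.of_forall fun x => ?_)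
    simp only [hF]
    rw [integral_const_mul, (integral_radial_weight hN (hq0 x)).2, gaussianWeight, mul_assoc]

theorem radialProfile_nonneg {u : ℝ} (hu : 0 ≤ u) : 0 ≤ radialProfile u :=
  mul_nonneg hu (exp_pos _).le

theorem radialProfile_le_exp (u : ℝ) : radialProfile u ≤ exp (-((u - 1) ^ 2 / 2)) := by
  have h1 : u ≤ exp (u - 1) := by linarith [add_one_le_exp (u - 1)]
  calc radialProfile u ≤ exp (u - 1) * exp ((1 - u ^ 2) / 2) :=
        mul_le_mul_of_nonneg_right h1 (exp_pos _).le
    _ = exp (-((u - 1) ^ 2 / 2)) := by rw [← exp_add]; congr 1; ring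

theorem integrableOn_mul_radialProfile :
    IntegrableOn (fun u => u * radialProfile u) (Set.Ioi 0) := by
  have h := (integrable_rpow_mul_exp_neg_mul_sq (b := 1 / 2) (s := 2) (by norm_num)
    (by norm_num)).const_mul (exp (1 / 2))
  refine h.integrableOn.congr_fun (fun u _ => ?_) measurableSet_Ioi
  simp only [radialProfile]
  rw [show (1 - u ^ 2) / 2 = 1 / 2 + -(1 / 2) * u ^ 2 by ring, exp_add]
  norm_cast
  ring

theorem mul_radialProfile_pow_succ_le {ε : ℝ} (hε : 0 ≤ ε) (M : ℕ) {u : ℝ} (hu : 0 < u)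
    (h : ε ≤ |u - 1|) : u * radialProfile u ^ (M + 1) ≤
      exp (-(M * (ε ^ 2 / 2))) * (u * radialProfile u) := by
  have h1 : radialProfile u ≤ exp (-(ε ^ 2 / 2)) := by
    refine (radialProfile_le_exp u).trans (exp_le_exp.2 ?_)
    have := pow_le_pow_left₀ hε h 2
    rw [sq_abs] at this
    linarith
  have h2 := pow_le_pow_left₀ (radialProfile_nonneg hu.le) h1 M
  rw [← exp_nat_mul, mul_neg] at h2
  have h3 := mul_le_mul_of_nonneg_left h2 (mul_nonneg hu.le (radialProfile_nonneg hu.le))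
  linarith [pow_succ (radialProfile u) M, show u * radialProfile u ^ (M + 1) =
    u * radialProfile u * radialProfile u ^ M by ring]

theorem integrableOn_mul_radialProfile_pow {M : ℕ} (hM : 0 < M) :
    IntegrableOn (fun u => u * radialProfile u ^ M) (Set.Ioi 0) := by
  obtain ⟨M, rfl⟩ := Nat.exists_eq_succ_of_ne_zero hM.ne'
  refine integrableOn_mul_radialProfile.mono' ?_ ?_
  · exact (continuous_id.mul (continuous_radialProfile.pow _)).aestronglyMeasurable
  · refine (ae_restrict_mem measurableSet_Ioi).mono fun u hu => ?_
    have hu' : (0 : ℝ) < u := hu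
    rw [Real.norm_of_nonneg (mul_nonneg hu'.le (pow_nonneg (radialProfile_nonneg hu'.le) _))]
    simpa using mul_radialProfile_pow_succ_le le_rfl M hu' (abs_nonneg _)

theorem setIntegral_radialProfile_tail_le {ε : ℝ} (hε : 0 ≤ ε) (M : ℕ) :
    ∫ u in Set.Ioi 0, {u : ℝ | ε < |u - 1|}.indicator (fun u => u * radialProfile u ^ (M + 1)) u ≤
      exp (-(M * (ε ^ 2 / 2))) * ∫ u in Set.Ioi 0, u * radialProfile u := by
  rw [← integral_const_mul]
  refine setIntegral_mono_on ?_ (integrableOn_mul_radialProfile.const_mul _) measurableSet_Ioi ?_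
  · exact (integrableOn_mul_radialProfile_pow M.succ_pos).indicator
      (isOpen_lt continuous_const (by fun_prop)).measurableSet
  · intro u hu
    have hu' : (0 : ℝ) < u := hu
    refine Set.indicator_apply_le' (fun h => ?_) fun _ => ?_
    · exact mul_radialProfile_pow_succ_le hε M hu' (le_of_lt h)
    · exact mul_nonneg (exp_pos _).le (mul_nonneg hu'.le (radialProfile_nonneg hu'.le))

theorem le_setIntegral_radialProfile {M : ℕ} (hM : 0 < M) :
    exp (-(3 / 2)) / M ≤ ∫ u in Set.Ioi 0, u * radialProfile u ^ M := by
  have hM' : (1 : ℝ) ≤ M := by exact_mod_cast hM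
  have hinteg := integrableOn_mul_radialProfile_pow hM
  have hsub : Set.Icc (1 : ℝ) (1 + 1 / M) ⊆ Set.Ioi 0 := fun u hu => by
    have := hu.1
    exact lt_of_lt_of_le one_pos this
  have h1 : ∫ u in Set.Icc (1 : ℝ) (1 + 1 / M), u * radialProfile u ^ M ≤
      ∫ u in Set.Ioi 0, u * radialProfile u ^ M := by
    refine setIntegral_mono_set hinteg ?_ hsub.eventuallyLE
    refine (ae_restrict_mem measurableSet_Ioi).mono fun u hu => ?_
    exact mul_nonneg (le_of_lt hu) (pow_nonneg (radialProfile_nonneg (le_of_lt hu)) _)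
  have h2 : ∫ u in Set.Icc (1 : ℝ) (1 + 1 / M), exp (-(3 / 2)) ≤
      ∫ u in Set.Icc (1 : ℝ) (1 + 1 / M), u * radialProfile u ^ M := by
    refine setIntegral_mono_on (by simp) (hinteg.mono_set hsub) measurableSet_Icc ?_
    intro u hu
    have hd : u - 1 ≤ 1 / M := by linarith [hu.2]
    have hd1 : (1 : ℝ) / M ≤ 1 := by rw [div_le_one (by linarith)]; exact hM'
    have hsq : u ^ 2 - 1 ≤ 3 / M := by
      have h3 : (u - 1) * (u + 1) ≤ 1 / M * 3 :=
        mul_le_mul hd (by linarith) (by linarith [hu.1]) (by positivity)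
      calc u ^ 2 - 1 = (u - 1) * (u + 1) := by ring
        _ ≤ _ := h3.trans (le_of_eq (by ring))
    have hφ : exp (-(3 / (2 * M))) ≤ radialProfile u := by
      calc exp (-(3 / (2 * M))) ≤ exp ((1 - u ^ 2) / 2) := by
            refine exp_le_exp.2 ?_
            have : (3 : ℝ) / (2 * M) = 3 / M / 2 := by rw [div_div, mul_comm]
            linarith
        _ ≤ radialProfile u := le_mul_of_one_le_left (exp_pos _).le hu.1
    have hpow := pow_le_pow_left₀ (exp_pos _).le hφ M
    rw [← exp_nat_mul, show (M : ℝ) * -(3 / (2 * M)) = -(3 / 2) by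
      field_simp] at hpow
    exact hpow.trans (le_mul_of_one_le_left
      (pow_nonneg (radialProfile_nonneg (by linarith [hu.1])) _) hu.1)
  refine le_trans (le_of_eq ?_) (h2.trans h1)
  simp [div_eq_mul_inv, mul_comm]

theorem tendsto_radialProfile_tail (n : ℕ) {ε : ℝ} (hε : 0 < ε) :
    Tendsto (fun N : ℕ => (N : ℝ) ^ n *
      ((∫ u in Set.Ioi 0, {u : ℝ | ε < |u - 1|}.indicator
        (fun u => u * radialProfile u ^ (N ^ 2)) u) /
        ∫ u in Set.Ioi 0, u * radialProfile u ^ (N ^ 2))) atTop (𝓝 0) := by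
  set A := ∫ u in Set.Ioi 0, u * radialProfile u with hA
  have hA0 : 0 ≤ A := setIntegral_nonneg measurableSet_Ioi fun u hu =>
    mul_nonneg (le_of_lt hu) (radialProfile_nonneg (le_of_lt hu))
  have hlim : Tendsto (fun N : ℕ => (N : ℝ) ^ ((n + 2 : ℕ) : ℝ) * exp (-(ε ^ 2 / 2) * N) *
      (exp (ε ^ 2 / 2) * A * exp (3 / 2))) atTop (𝓝 0) := by
    simpa using ((tendsto_rpow_mul_exp_neg_mul_atTop_nhds_zero ((n + 2 : ℕ) : ℝ) (ε ^ 2 / 2)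
      (by positivity)).comp tendsto_natCast_atTop_atTop).mul_const
        (exp (ε ^ 2 / 2) * A * exp (3 / 2))
  refine squeeze_zero' ?_ ?_ hlim
  · refine Eventually.of_forall fun N => mul_nonneg (by positivity) (div_nonneg ?_ ?_)
    · exact setIntegral_nonneg measurableSet_Ioi fun u hu => Set.indicator_apply_nonneg fun _ =>
        mul_nonneg (le_of_lt hu) (pow_nonneg (radialProfile_nonneg (le_of_lt hu)) _)
    · exact setIntegral_nonneg measurableSet_Ioi fun u hu =>
        mul_nonneg (le_of_lt hu) (pow_nonneg (radialProfile_nonneg (le_of_lt hu)) _)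
  · filter_upwards [eventually_gt_atTop 0] with N hN
    have hN' : (1 : ℝ) ≤ N := by exact_mod_cast hN
    obtain ⟨M, hM⟩ := Nat.exists_eq_succ_of_ne_zero (pow_ne_zero 2 hN.ne')
    have hMN : (M : ℝ) + 1 = (N : ℝ) ^ 2 := by exact_mod_cast hM.symm
    have htail := setIntegral_radialProfile_tail_le hε.le M
    have hlow := le_setIntegral_radialProfile M.succ_pos
    rw [← Nat.succ_eq_add_one, ← hM] at htail
    rw [← hM] at hlow
    have hlow' : 0 < exp (-(3 / 2)) / ((N ^ 2 : ℕ) : ℝ) := by positivity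
    have hexp : exp (-(M * (ε ^ 2 / 2))) ≤ exp (ε ^ 2 / 2) * exp (-(ε ^ 2 / 2) * N) := by
      rw [← exp_add]
      refine exp_le_exp.2 ?_
      have : (N : ℝ) - 1 ≤ M := by nlinarith
      nlinarith [mul_le_mul_of_nonneg_right this (by positivity : 0 ≤ ε ^ 2 / 2)]
    calc _ ≤ (N : ℝ) ^ n * ((exp (-(M * (ε ^ 2 / 2))) * A) /
          (exp (-(3 / 2)) / ((N ^ 2 : ℕ) : ℝ))) := by
          refine mul_le_mul_of_nonneg_left ?_ (by positivity)
          exact div_le_div₀ (by positivity) htail hlow' hlow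
      _ = (N : ℝ) ^ (n + 2) * exp (-(M * (ε ^ 2 / 2))) * (A * exp (3 / 2)) := by
          rw [exp_neg (3 / 2)]
          push_cast
          field_simp
          ring
      _ ≤ (N : ℝ) ^ (n + 2) * (exp (ε ^ 2 / 2) * exp (-(ε ^ 2 / 2) * N)) * (A * exp (3 / 2)) := by
          gcongr
      _ = _ := by rw [Real.rpow_natCast]; ring

theorem isCompact_traceBall (N : ℕ) (r : ℝ) : IsCompact (traceBall N r) := by
  refine Metric.isCompact_of_isClosed_isBounded (isClosed_traceBall N r) ?_
  refine (Metric.isBounded_closedBall (x := (0 : Fin N → ℝ)) (r := |r|)).subset fun x hx => ?_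
  rw [mem_closedBall_zero_iff, pi_norm_le_iff_of_nonneg (abs_nonneg r)]
  intro i
  refine sq_le_sq.1 (le_trans ?_ (Set.mem_ofPred_eq.mp hx))
  exact Finset.single_le_sum (f := fun i => x i ^ 2) (fun j _ => sq_nonneg _) (Finset.mem_univ i)

theorem integrable_ball_indicator (N : ℕ) (r : ℝ) {h : (Fin N → ℝ) → ℝ} (hc : Continuous h) :
    Integrable ((traceBall N r).indicator fun x => h x * vand 2 N x) :=
  (integrable_indicator_iff (isClosed_traceBall N r).measurableSet).2
    ((hc.mul (continuous_vand_two N)).continuousOn.integrableOn_compact (isCompact_traceBall N r))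

theorem ballIntegral_mono {N : ℕ} {r : ℝ} {h k : (Fin N → ℝ) → ℝ} (hh : Continuous h)
    (hk : Continuous k) (hle : ∀ x, h x ≤ k x) : ballIntegral N r h ≤ ballIntegral N r k := by
  refine integral_mono (integrable_ball_indicator N r hh) (integrable_ball_indicator N r hk) ?_
  exact fun x => Set.indicator_le_indicator
    (mul_le_mul_of_nonneg_right (hle x) (vand_two_nonneg x))

theorem ballIntegral_const_mul (N : ℕ) (r c : ℝ) (h : (Fin N → ℝ) → ℝ) :
    ballIntegral N r (fun x => c * h x) = c * ballIntegral N r h := by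
  rw [ballIntegral, ballIntegral, ← integral_const_mul]
  refine integral_congr_ae (Eventually.of_forall fun x => ?_)
  by_cases hx : x ∈ traceBall N r
  · simp only [Set.indicator_of_mem hx]; ring
  · simp only [Set.indicator_of_notMem hx, mul_zero]

theorem ballIntegral_sub {N : ℕ} {r : ℝ} {h k : (Fin N → ℝ) → ℝ} (hh : Continuous h)
    (hk : Continuous k) :
    ballIntegral N r (fun x => h x - k x) = ballIntegral N r h - ballIntegral N r k := by
  rw [ballIntegral, ballIntegral, ballIntegral, ← integral_sub (integrable_ball_indicator N r hh)
    (integrable_ball_indicator N r hk)]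
  refine integral_congr_ae (Eventually.of_forall fun x => ?_)
  by_cases hx : x ∈ traceBall N r
  · simp only [Set.indicator_of_mem hx]; ring
  · simp only [Set.indicator_of_notMem hx, sub_zero]

theorem ballIntegral_nonneg {N : ℕ} {r : ℝ} {h : (Fin N → ℝ) → ℝ} (hh : ∀ x, 0 ≤ h x) :
    0 ≤ ballIntegral N r h :=
  integral_nonneg fun x => Set.indicator_nonneg
    (fun x _ => mul_nonneg (hh x) (vand_two_nonneg x)) x

theorem abs_ballIntegral_le {N : ℕ} {r : ℝ} {h k : (Fin N → ℝ) → ℝ} (hh : Continuous h)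
    (hk : Continuous k) (hle : ∀ x, |h x| ≤ k x) : |ballIntegral N r h| ≤ ballIntegral N r k := by
  rw [abs_le]
  constructor
  · have := ballIntegral_mono (r := r) (h := fun x => -1 * k x) (by fun_prop) hh
      fun x => by simpa using (abs_le.1 (hle x)).1
    rw [ballIntegral_const_mul] at this
    linarith
  · exact ballIntegral_mono hh hk fun x => (abs_le.1 (hle x)).2

theorem integral_gaussianWeight_eq_mul {N : ℕ} (hN : 0 < N) :
    ∫ x, gaussianWeight N x = (N : ℝ) ^ 2 * exp (-((N : ℝ) ^ 2 / 2)) *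
      ((∫ u in Set.Ioi (0 : ℝ), u * radialProfile u ^ (N ^ 2)) * ballIntegral N N fun _ => 1) := by
  have h := (integrableOn_mixture_and_eq hN (h := fun _ => 1) continuous_const (B := 1)
    (by simp)).2
  simpa only [one_mul, integral_mul_const] using h

theorem abs_ball_sub_gaussian_le {N : ℕ} (hN : 0 < N) {h k : (Fin N → ℝ) → ℝ}
    (hh : Continuous h) (hk : Continuous k) {B D ε η : ℝ} (hB : ∀ x, |h x| ≤ B)
    (hD : ∀ x, |k x| ≤ D) (hη : 0 ≤ η) (hk0 : ∀ x, 0 ≤ k x)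
    (hclose : ∀ u : ℝ, 0 < u → |u - 1| ≤ ε → ∀ x, |h x - h (u • x)| ≤ η * k (u • x)) :
    |(ballIntegral N N fun _ => 1)⁻¹ * ballIntegral N N h -
      (∫ x, gaussianWeight N x)⁻¹ * ∫ x, h x * gaussianWeight N x| ≤
    η * ((∫ x, gaussianWeight N x)⁻¹ * ∫ x, k x * gaussianWeight N x) +
      2 * B * ((∫ u in Set.Ioi 0, {u : ℝ | ε < |u - 1|}.indicator
        (fun u => u * radialProfile u ^ (N ^ 2)) u) /
        ∫ u in Set.Ioi 0, u * radialProfile u ^ (N ^ 2)) := by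
  have hN' : (0 : ℝ) < N := by exact_mod_cast hN
  obtain ⟨hhi, hhe⟩ := integrableOn_mixture_and_eq hN hh hB
  obtain ⟨hki, hke⟩ := integrableOn_mixture_and_eq hN hk hD
  have hG := integral_gaussianWeight_pos N
  have hGe := integral_gaussianWeight_eq_mul hN
  have hPi := integrableOn_mul_radialProfile_pow (M := N ^ 2) (by positivity)
  have hI : 0 < ∫ u in Set.Ioi 0, u * radialProfile u ^ (N ^ 2) :=
    lt_of_lt_of_le (by positivity) (le_setIntegral_radialProfile (M := N ^ 2) (by positivity))
  rw [hGe] at hG ⊢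
  rw [hhe, hke]
  set c : ℝ := (N : ℝ) ^ 2 * exp (-((N : ℝ) ^ 2 / 2)) with hc
  have hc0 : 0 < c := by positivity
  set P : ℝ → ℝ := fun u => u * radialProfile u ^ (N ^ 2) with hP
  set I := ∫ u in Set.Ioi 0, P u with hIdef
  set Z := ballIntegral N N fun _ => 1 with hZdef
  set T := ∫ u in Set.Ioi 0, {u : ℝ | ε < |u - 1|}.indicator P u with hT
  have hZ : 0 < Z := by
    have := (pos_iff_pos_of_mul_pos hG).1 hc0
    exact (pos_iff_pos_of_mul_pos this).1 hI
  have hB0 : 0 ≤ B := (abs_nonneg _).trans (hB 0)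
  have hP0 : ∀ u ∈ Set.Ioi (0 : ℝ), 0 ≤ P u := fun u hu =>
    mul_nonneg (le_of_lt hu) (pow_nonneg (radialProfile_nonneg (le_of_lt hu)) _)
  have hTi : IntegrableOn ({u : ℝ | ε < |u - 1|}.indicator P) (Set.Ioi 0) :=
    hPi.indicator (isOpen_lt continuous_const (by fun_prop)).measurableSet
  have hpt : ∀ u ∈ Set.Ioi (0 : ℝ),
      ‖P u * ballIntegral N N h - P u * ballIntegral N N (fun x => h (u • x))‖ ≤
        η * (P u * ballIntegral N N (fun x => k (u • x))) +
          2 * B * Z * {u : ℝ | ε < |u - 1|}.indicator P u := by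
    intro u hu
    have hhu : Continuous fun x : Fin N → ℝ => h (u • x) := hh.comp (continuous_const_smul u)
    have hku : Continuous fun x : Fin N → ℝ => k (u • x) := hk.comp (continuous_const_smul u)
    rw [← mul_sub, norm_mul, Real.norm_of_nonneg (hP0 u hu), Real.norm_eq_abs,
      ← ballIntegral_sub hh hhu]
    by_cases hε : ε < |u - 1|
    · rw [Set.indicator_of_mem (s := {u : ℝ | ε < |u - 1|}) hε]
      have h1 : |ballIntegral N N fun x => h x - h (u • x)| ≤ 2 * B * Z := by
        rw [hZdef, ← ballIntegral_const_mul]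
        refine abs_ballIntegral_le (hh.sub hhu) (by fun_prop) fun x => ?_
        have := abs_sub (h x) (h (u • x))
        linarith [hB x, hB (u • x)]
      have h2 : 0 ≤ η * (P u * ballIntegral N N (fun x => k (u • x))) :=
        mul_nonneg hη (mul_nonneg (hP0 u hu) (ballIntegral_nonneg fun x => hk0 _))
      linarith [mul_le_mul_of_nonneg_left h1 (hP0 u hu)]
    · rw [Set.indicator_of_notMem (s := {u : ℝ | ε < |u - 1|}) hε, mul_zero, add_zero,
        mul_left_comm, ← ballIntegral_const_mul]
      exact mul_le_mul_of_nonneg_left (abs_ballIntegral_le (hh.sub hhu) (hku.const_smul η)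
        (hclose u hu (not_lt.1 hε))) (hP0 u hu)
  have hsum : |∫ u in Set.Ioi 0, (P u * ballIntegral N N h -
      P u * ballIntegral N N (fun x => h (u • x)))| ≤
      η * (∫ u in Set.Ioi 0, P u * ballIntegral N N (fun x => k (u • x))) + 2 * B * Z * T := by
    rw [← integral_const_mul, hT, ← integral_const_mul,
      ← integral_add (hki.const_mul η) (hTi.const_mul _)]
    exact norm_integral_le_of_norm_le ((hki.const_mul η).add (hTi.const_mul _))
      ((ae_restrict_mem measurableSet_Ioi).mono hpt)
  rw [integral_sub (hPi.mul_const _) hhi, integral_mul_const] at hsum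
  set Jh := ∫ u in Set.Ioi 0, P u * ballIntegral N N (fun x => h (u • x))
  set Jk := ∫ u in Set.Ioi 0, P u * ballIntegral N N (fun x => k (u • x))
  have e1 : Z⁻¹ * ballIntegral N N h - (c * (I * Z))⁻¹ * (c * Jh) =
      (I * Z)⁻¹ * (I * ballIntegral N N h - Jh) := by
    field_simp
  have e2 : η * ((c * (I * Z))⁻¹ * (c * Jk)) + 2 * B * (T / I) =
      (I * Z)⁻¹ * (η * Jk + 2 * B * Z * T) := by
    field_simp
  rw [e1, e2, abs_mul, abs_of_pos (by positivity : 0 < (I * Z)⁻¹)]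
  exact mul_le_mul_of_nonneg_left hsum (by positivity)

theorem Zbt_two_eq (N : ℕ) (r : ℝ) : Zbt 2 N r = ballIntegral N r fun _ => 1 := by
  simp only [ballIntegral, one_mul]
  rfl

theorem integral_mul_Rbt_eq {n N : ℕ} (hN : 0 < N) (h : n ≤ N) {f : (Fin n → ℝ) → ℝ}
    (hf : Continuous f) :
    ∫ t : Fin n → ℝ, f t * (π / (2 * N)) ^ n * Rbt 2 n N (√N / 2) (fun i => π * t i / (2 * N)) =
      (N.factorial : ℝ) / (N - n).factorial * ((ballIntegral N N fun _ => 1)⁻¹ *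
        ballIntegral N N fun x => f ((√N / π) • (x ∘ Fin.castLE h))) := by
  have hN' : (0 : ℝ) < N := by exact_mod_cast hN
  have hs : 0 < √(N : ℝ) := Real.sqrt_pos.2 hN'
  have hrad : (N : ℝ) = 2 * √N * (√N / 2) := by
    rw [mul_div_assoc', mul_right_comm, mul_assoc, Real.mul_self_sqrt hN'.le]; ring
  have hcoef : √N / π * (2 * √N) = 2 * N / π := by
    rw [div_mul_eq_mul_div, mul_left_comm, Real.mul_self_sqrt hN'.le]
  have hball : ∀ k : (Fin N → ℝ) → ℝ, ballIntegral N N k = (2 * √N) ^ (N ^ 2) *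
      ballIntegral N (√N / 2) fun x => k ((2 * √N) • x) := by
    intro k
    rw [← ballIntegral_mul_radius (by positivity), ← hrad]
  have hcastsmul : ∀ x : Fin N → ℝ, (√N / π) • (((2 * √N) • x) ∘ Fin.castLE h) =
      (2 * N / π) • (x ∘ Fin.castLE h) := by
    intro x
    rw [← hcoef, mul_smul (√(N : ℝ) / π) (2 * √N)]
    rfl
  set V : (Fin N → ℝ) → ℝ := (traceBall N (√N / 2)).indicator (vand 2 N) with hV
  have hR : ∀ t : Fin n → ℝ, f t * (π / (2 * N)) ^ n *
      Rbt 2 n N (√N / 2) (fun i => π * t i / (2 * N)) =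
      ((N.factorial : ℝ) / (N - n).factorial * (Zbt 2 N (√N / 2))⁻¹ * (π / (2 * N)) ^ n) *
        (f t * ∫ y, V (combine N n ((π / (2 * N)) • t) y)) := by
    intro t
    have harg : (fun i => π * t i / (2 * N)) = (π / (2 * N : ℝ)) • t := by
      funext i
      simp [div_mul_eq_mul_div]
    rw [harg, Rbt, hV, traceBall]
    ring
  have hinteg : Integrable fun x : Fin N → ℝ => f ((2 * N / π : ℝ) • (x ∘ Fin.castLE h)) * V x := by
    have := integrable_ball_indicator N (√N / 2)
      (h := fun x => f ((2 * N / π : ℝ) • (x ∘ Fin.castLE h))) (hf.comp (by fun_prop))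
    refine this.congr (Eventually.of_forall fun x => ?_)
    by_cases hx : x ∈ traceBall N (√N / 2) <;> simp [hV, hx]
  have hscale := Measure.integral_comp_smul (volume : Measure (Fin n → ℝ))
    (fun x => f ((2 * N / π : ℝ) • x) * ∫ y, V (combine N n x y)) (π / (2 * N))
  have hone : 2 * (N : ℝ) / π * (π / (2 * N)) = 1 := by
    field_simp
  simp only [smul_smul, hone, one_smul, Module.finrank_fintype_fun_eq_card, Fintype.card_fin,
    smul_eq_mul] at hscale
  rw [abs_of_pos (by positivity), eq_inv_mul_iff_mul_eq₀ (by positivity)] at hscale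
  have hfub : ∫ x : Fin n → ℝ, f ((2 * N / π : ℝ) • x) * ∫ y, V (combine N n x y) =
      ballIntegral N (√N / 2) fun x => f ((2 * N / π : ℝ) • (x ∘ Fin.castLE h)) := by
    have h1 := integral_eq_integral_combine h hinteg
    simp only [combine_castLE, integral_const_mul] at h1
    rw [← h1, ballIntegral]
    refine integral_congr_ae (Eventually.of_forall fun x => ?_)
    by_cases hx : x ∈ traceBall N (√N / 2) <;> simp [hV, hx]
  simp_rw [hR, integral_const_mul]
  rw [mul_assoc, hscale, hfub, Zbt_two_eq, hball, hball fun x => f _]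
  simp only [hcastsmul]
  have : (2 * √(N : ℝ)) ^ (N ^ 2) ≠ 0 := by positivity
  rw [mul_inv, mul_mul_mul_comm, inv_mul_cancel₀ this, one_mul, mul_assoc]

/-- Small dilations of a compactly supported function are controlled by a fixed bump. -/
theorem exists_dilation_modulus {n : ℕ} {f : (Fin n → ℝ) → ℝ} (hf : Continuous f)
    (hsupp : HasCompactSupport f) :
    ∃ g : (Fin n → ℝ) → ℝ, Continuous g ∧ HasCompactSupport g ∧ (∀ t, 0 ≤ g t) ∧
      ∀ η : ℝ, 0 < η → ∃ ε : ℝ, 0 < ε ∧ ∀ u : ℝ, 0 < u → |u - 1| ≤ ε →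
        ∀ t, |f t - f (u • t)| ≤ η * g (u • t) := by
  obtain ⟨R₀, hR₀⟩ := hsupp.isCompact.isBounded.exists_norm_le
  set R := max R₀ 0 with hRdef
  have hR0 : 0 ≤ R := le_max_right _ _
  have hzero : ∀ t, R < ‖t‖ → f t = 0 := by
    intro t ht
    by_contra hne
    exact absurd (hR₀ t (subset_tsupport f hne)) (not_le.2 ((le_max_left _ _).trans_lt ht))
  refine ⟨fun t => max 0 (4 * R + 1 - ‖t‖), by fun_prop, ?_, fun t => le_max_left _ _, ?_⟩
  · refine HasCompactSupport.intro (isCompact_closedBall (0 : Fin n → ℝ) (4 * R + 1)) fun t ht => ?_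
    rw [mem_closedBall_zero_iff, not_le] at ht
    exact max_eq_left (by linarith)
  intro η hη
  obtain ⟨δ, hδ, huc⟩ := Metric.uniformContinuous_iff.1
    (hsupp.uniformContinuous_of_continuous hf) η hη
  refine ⟨min (1 / 2) (δ / (2 * R + 1)), lt_min (by norm_num) (by positivity), ?_⟩
  intro u hu hclose t
  have h1 := abs_le.1 (hclose.trans (min_le_left _ _))
  have h2 := hclose.trans (min_le_right _ _)
  have hnorm : ‖u • t‖ = u * ‖t‖ := by rw [norm_smul, Real.norm_of_nonneg hu.le]
  rcases le_or_gt ‖t‖ (2 * R) with ht | ht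
  · have hg : 1 ≤ max 0 (4 * R + 1 - ‖u • t‖) := by
      refine le_max_of_le_right ?_
      rw [hnorm]
      nlinarith [norm_nonneg t]
    have hd : dist t (u • t) < δ := by
      rw [dist_comm, dist_eq_norm, show u • t - t = (u - 1) • t by rw [sub_smul, one_smul],
        norm_smul, Real.norm_eq_abs]
      have h3 : |u - 1| * ‖t‖ ≤ δ / (2 * R + 1) * (2 * R) :=
        mul_le_mul h2 ht (norm_nonneg _) (by positivity)
      refine h3.trans_lt ?_
      rw [div_mul_eq_mul_div, div_lt_iff₀ (by positivity)]
      nlinarith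
    exact (huc hd).le.trans (le_mul_of_one_le_right hη.le hg)
  · rw [hzero t (by linarith), hzero (u • t) (by rw [hnorm]; nlinarith), sub_zero, abs_zero]
    exact mul_nonneg hη.le (le_max_left _ _)

theorem factorial_div_factorial_sub_le {n N : ℕ} (h : n ≤ N) :
    (N.factorial : ℝ) / (N - n).factorial ≤ (N : ℝ) ^ n := by
  rw [div_le_iff₀ (by positivity)]
  have := Nat.mul_le_mul_left (N - n).factorial (Nat.descFactorial_le_pow N n)
  rw [Nat.factorial_mul_descFactorial h, mul_comm] at this
  exact_mod_cast this

/-- Sine-kernel universality at zero for the bounded trace GUE. -/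
theorem bounded_trace_GUE_sine_at_zero (n : ℕ) (hn : 1 ≤ n)
    (f : (Fin n → ℝ) → ℝ) (hf : Continuous f) (hsupp : HasCompactSupport f) :
    Filter.Tendsto
      (fun N : ℕ => ∫ t : Fin n → ℝ,
        f t * (π / (2 * N)) ^ n *
          Rbt 2 n N (Real.sqrt N / 2) (fun i => π * t i / (2 * N)))
      atTop
      (𝓝 (∫ t : Fin n → ℝ,
        f t * Matrix.det (Matrix.of fun j k : Fin n => Ksine (t j) (t k)))) := by
  obtain ⟨g, hg, hgsupp, hg0, hgf⟩ := exists_dilation_modulus hf hsupp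
  obtain ⟨B, hB⟩ := hf.bounded_above_of_compact_support hsupp
  obtain ⟨D, hD⟩ := hg.bounded_above_of_compact_support hgsupp
  have hB0 : 0 ≤ B := (norm_nonneg _).trans (hB 0)
  have hlimf := tendsto_integral_det_hermite_kernel hf hsupp
  have hlimg := tendsto_integral_det_hermite_kernel hg hgsupp
  set L := ∫ t, g t * Matrix.det (Matrix.of fun j k : Fin n => Ksine (t j) (t k))
  suffices hdiff : Tendsto (fun N : ℕ => (∫ t : Fin n → ℝ, f t * (π / (2 * N)) ^ n *
      Rbt 2 n N (√N / 2) (fun i => π * t i / (2 * N))) -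
      ∫ t, f t * Matrix.det (Matrix.of fun i j : Fin n => π / √N *
        familyKernel (fun k : Fin N => hermiteFun k) (π * t i / √N) (π * t j / √N))) atTop
      (𝓝 0) by
    simpa using hdiff.add hlimf
  rw [Metric.tendsto_nhds]
  intro e he
  have hη : 0 < e / (2 * (|L| + 1)) := by positivity
  obtain ⟨ε, hε, hclose⟩ := hgf _ hη
  have htail := ((tendsto_radialProfile_tail n hε).const_mul (2 * B))
  rw [mul_zero] at htail
  filter_upwards [eventually_gt_atTop 0, eventually_ge_atTop n,
    htail.eventually_lt_const (half_pos he),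
    hlimg.eventually_lt_const (show L < |L| + 1 by linarith [le_abs_self L])] with N hN hnN ht hgN
  set c : ℝ := (N.factorial : ℝ) / (N - n).factorial with hc
  have hc0 : 0 ≤ c := by positivity
  have hcont : ∀ k : (Fin n → ℝ) → ℝ, Continuous k →
      Continuous fun x : Fin N → ℝ => k ((√N / π) • (x ∘ Fin.castLE hnN)) :=
    fun k hk => hk.comp (by fun_prop)
  have key := abs_ball_sub_gaussian_le hN (hcont f hf) (hcont g hg) (fun x => hB _)
    (fun x => hD _) hη.le (fun x => hg0 _) (ε := ε) (fun u hu hu1 x => by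
      have := hclose u hu hu1 ((√N / π) • (x ∘ Fin.castLE hnN))
      rwa [smul_comm] at this)
  rw [integral_mul_Rbt_eq hN hnN hf, ← gaussian_correlation hN hnN hf hB, Real.dist_eq, sub_zero,
    mul_assoc, ← mul_sub, abs_mul, abs_of_nonneg hc0]
  rw [← gaussian_correlation hN hnN hg hD, mul_assoc] at hgN
  set T := (∫ u in Set.Ioi 0, {u : ℝ | ε < |u - 1|}.indicator
        (fun u => u * radialProfile u ^ (N ^ 2)) u) /
        ∫ u in Set.Ioi 0, u * radialProfile u ^ (N ^ 2) with hT
  have hT0 : 0 ≤ T := by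
    refine div_nonneg (setIntegral_nonneg measurableSet_Ioi fun u hu => ?_)
      (setIntegral_nonneg measurableSet_Ioi fun u hu => ?_)
    · exact Set.indicator_apply_nonneg fun _ =>
        mul_nonneg (le_of_lt hu) (pow_nonneg (radialProfile_nonneg (le_of_lt hu)) _)
    · exact mul_nonneg (le_of_lt hu) (pow_nonneg (radialProfile_nonneg (le_of_lt hu)) _)
  refine (mul_le_mul_of_nonneg_left key hc0).trans_lt ?_
  rw [mul_add, mul_left_comm c]
  have h1 : e / (2 * (|L| + 1)) * (c * ((∫ x, gaussianWeight N x)⁻¹ *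
      ∫ x, g ((√N / π) • (x ∘ Fin.castLE hnN)) * gaussianWeight N x)) ≤ e / 2 := by
    refine (mul_le_mul_of_nonneg_left hgN.le hη.le).trans (le_of_eq ?_)
    have : |L| + 1 ≠ 0 := by positivity
    field_simp
  have h2 : c * (2 * B * T) ≤ 2 * B * ((N : ℝ) ^ n * T) := by
    rw [mul_left_comm]
    exact mul_le_mul_of_nonneg_left
      (mul_le_mul_of_nonneg_right (factorial_div_factorial_sub_le hnN) hT0) (by positivity)
  linarith
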